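/- arXiv:1305.6290 — 4 statements merged into one kernel-verified Lean document; each statement's English description precedes it below -/
import Mathlib

section
/- (Semigroup property of the multi-time Lax formula.) For each 0 ≤ s₁ < t₁, 0 ≤ s₂ < t₂ and all x ∈ ℝ^d, w(t₁,t₂,x) = min_{y ∈ ℝ^d} { ((t₁−s₁)H₁ + (t₂−s₂)H₂)*(x − y) + w(s₁,s₂,y) }, where w(0,0,·) = g. -/
open Filter Topology
open scoped RealInnerProductSpace

/-- `f` is coercive: `f x / ‖x‖ → +∞` as `‖x‖ → ∞`. -/
def Coercive {d : ℕ} (f : EuclideanSpace ℝ (Fin d) → ℝ) : Prop :=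
  Tendsto (fun x => f x / ‖x‖) (Filter.comap (fun x : EuclideanSpace ℝ (Fin d) => ‖x‖) atTop) atTop

/-- The (real-valued) Legendre–Fenchel conjugate `f*(p) = sup_y (⟪p,y⟫ - f y)`. -/
noncomputable def legendreConj {d : ℕ} (f : EuclideanSpace ℝ (Fin d) → ℝ)
    (p : EuclideanSpace ℝ (Fin d)) : ℝ :=
  ⨆ y, (⟪p, y⟫ - f y)

/-- The multi-time Lax formula `w(t₁,t₂,x) = inf_y { (t₁H₁ + t₂H₂)*(x - y) + g y }` for
`(t₁,t₂) ≠ (0,0)`, with `w(0,0,·) = g`. -/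
noncomputable def lax {d : ℕ} (H₁ H₂ g : EuclideanSpace ℝ (Fin d) → ℝ) (t₁ t₂ : ℝ)
    (x : EuclideanSpace ℝ (Fin d)) : ℝ :=
  if t₁ = 0 ∧ t₂ = 0 then g x
  else ⨅ y, (legendreConj (fun ξ => t₁ * H₁ ξ + t₂ * H₂ ξ) (x - y) + g y)

namespace LaxAux

variable {d : ℕ}

/-- superlinear growth -/
def SL (F : EuclideanSpace ℝ (Fin d) → ℝ) : Prop :=
  ∀ M : ℝ, ∃ B : ℝ, ∀ ξ, M * ‖ξ‖ - B ≤ F ξ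

lemma cvx_cont {F : EuclideanSpace ℝ (Fin d) → ℝ} (h : ConvexOn ℝ Set.univ F) : Continuous F :=
  h.locallyLipschitz.continuous

lemma SL_of_coercive {F : EuclideanSpace ℝ (Fin d) → ℝ} (hc : Continuous F) (h : Coercive F) :
    SL F := by
  intro M
  have h1 := h.eventually (eventually_ge_atTop M)
  rw [Filter.eventually_comap] at h1
  obtain ⟨R, hR⟩ := Filter.eventually_atTop.1 h1
  obtain ⟨B, hB⟩ := ((isCompact_closedBall (0 : EuclideanSpace ℝ (Fin d)) (max R 1)).image
    (f := fun ξ => M * ‖ξ‖ - F ξ) (by fun_prop)).bddAbove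
  refine ⟨max B 0, fun ξ => ?_⟩
  by_cases hξ : ‖ξ‖ ≤ max R 1
  · have := hB ⟨ξ, by simpa using hξ, rfl⟩
    simp only at this
    linarith [le_max_left B 0]
  · push Not at hξ
    have h2 := hR ‖ξ‖ ((le_max_left R 1).trans hξ.le) ξ rfl
    have h3 : 0 < ‖ξ‖ := by linarith [le_max_right R 1]
    rw [le_div_iff₀ h3] at h2
    linarith [le_max_right B 0]

lemma SL_comb {F G : EuclideanSpace ℝ (Fin d) → ℝ} (hF : SL F) (hG : SL G) {a b : ℝ}
    (ha : 0 < a) (hb : 0 ≤ b) : SL (fun ξ => a * F ξ + b * G ξ) := by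
  intro M
  obtain ⟨B, hB⟩ := hF (M / a)
  obtain ⟨C, hC⟩ := hG 0
  refine ⟨a * B + b * C, fun ξ => ?_⟩
  have h1 := mul_le_mul_of_nonneg_left (hB ξ) ha.le
  have h2 := mul_le_mul_of_nonneg_left (hC ξ) hb
  have h3 : a * (M / a * ‖ξ‖ - B) = M * ‖ξ‖ - a * B := by field_simp
  simp only
  linarith

lemma SL_comb' {F G : EuclideanSpace ℝ (Fin d) → ℝ} (hF : SL F) (hG : SL G) {a b : ℝ}
    (ha : 0 ≤ a) (hb : 0 ≤ b) (hab : ¬ (a = 0 ∧ b = 0)) : SL (fun ξ => a * F ξ + b * G ξ) := by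
  rcases ha.eq_or_lt with h | h
  · have hb' : 0 < b := lt_of_le_of_ne hb (fun h' => hab ⟨h.symm, h'.symm⟩)
    have := SL_comb hG hF hb' ha
    simpa [add_comm] using this
  · exact SL_comb hF hG h hb

lemma bdd {F : EuclideanSpace ℝ (Fin d) → ℝ} (hF : SL F) (p : EuclideanSpace ℝ (Fin d)) :
    BddAbove (Set.range fun y => ⟪p, y⟫ - F y) := by
  obtain ⟨B, hB⟩ := hF ‖p‖
  refine ⟨B, ?_⟩
  rintro _ ⟨y, rfl⟩
  have := real_inner_le_norm p y
  have := hB y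
  simp only
  linarith

lemma le_conj {F : EuclideanSpace ℝ (Fin d) → ℝ} (hF : SL F) (p y : EuclideanSpace ℝ (Fin d)) :
    ⟪p, y⟫ - F y ≤ legendreConj F p := le_ciSup (bdd hF p) y

lemma conj_convex {F : EuclideanSpace ℝ (Fin d) → ℝ} (hF : SL F) :
    ConvexOn ℝ Set.univ (legendreConj F) := by
  refine ⟨convex_univ, fun p _ q _ a b ha hb hab => ?_⟩
  refine ciSup_le fun y => ?_
  have h1 := mul_le_mul_of_nonneg_left (le_conj hF p y) ha
  have h2 := mul_le_mul_of_nonneg_left (le_conj hF q y) hb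
  simp only [inner_add_left, inner_smul_left, smul_eq_mul, RCLike.conj_to_real]
  have : F y = a * F y + b * F y := by rw [← add_mul, hab, one_mul]
  linarith

lemma conj_SL {F : EuclideanSpace ℝ (Fin d) → ℝ} (hF : SL F) (hc : Continuous F) :
    SL (legendreConj F) := by
  intro M
  obtain ⟨B, hB⟩ := ((isCompact_closedBall (0 : EuclideanSpace ℝ (Fin d)) |M|).image
    (f := F) hc).bddAbove
  refine ⟨B, fun p => ?_⟩
  have h1 := le_conj hF p ((M / ‖p‖) • p)
  have h2 : F ((M / ‖p‖) • p) ≤ B := by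
    refine hB ⟨_, ?_, rfl⟩
    rw [mem_closedBall_zero_iff, norm_smul, norm_div, norm_norm, Real.norm_eq_abs]
    rcases eq_or_ne ‖p‖ 0 with h | h
    · simp [h]
    · rw [div_mul_cancel₀ _ h]
  have h3 : ⟪p, (M / ‖p‖) • p⟫ = M * ‖p‖ := by
    rw [inner_smul_right, real_inner_self_eq_norm_sq]
    rcases eq_or_ne ‖p‖ 0 with h | h
    · simp [h]
    · field_simp
  linarith

lemma attain {F g : EuclideanSpace ℝ (Fin d) → ℝ} (hF : SL F) (hc : Continuous F)
    {K : NNReal} (hg : LipschitzWith K g) (x : EuclideanSpace ℝ (Fin d)) :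
    ∃ y₀, ∀ y, legendreConj F (x - y₀) + g y₀ ≤ legendreConj F (x - y) + g y := by
  have hcc := cvx_cont (conj_convex hF)
  have hgc := hg.continuous
  refine Continuous.exists_forall_le (f := fun y => legendreConj F (x - y) + g y)
    (by fun_prop) ?_
  obtain ⟨B, hB⟩ := conj_SL hF hc (K + 1)
  have ht : Tendsto (fun y : EuclideanSpace ℝ (Fin d) => ‖y‖ + (g x - B - ‖x‖))
      (cocompact _) atTop :=
    tendsto_atTop_add_const_right _ _ tendsto_norm_cocompact_atTop
  refine tendsto_atTop_mono (fun y => ?_) ht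
  have h1 := hB (x - y)
  have h2 := hg.dist_le_mul x y
  rw [Real.dist_eq, dist_eq_norm] at h2
  have h3 := le_abs_self (g x - g y)
  have h4 := norm_sub_norm_le y x
  rw [norm_sub_rev] at h4
  linarith

lemma sandwich {F G : EuclideanSpace ℝ (Fin d) → ℝ} (hF : ConvexOn ℝ Set.univ F)
    (hG : ConcaveOn ℝ Set.univ G) (h : ∀ ξ, G ξ ≤ F ξ) :
    ∃ (u : EuclideanSpace ℝ (Fin d)) (c : ℝ), ∀ ξ, G ξ ≤ ⟪u, ξ⟫ + c ∧ ⟪u, ξ⟫ + c ≤ F ξ := by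
  have hFc := cvx_cont hF
  obtain ⟨f, v, h1, h2⟩ := geometric_hahn_banach_open hF.convex_strict_epigraph
    (by
      have : IsOpen {p : EuclideanSpace ℝ (Fin d) × ℝ | F p.1 < p.2} :=
        isOpen_lt (by fun_prop) (by fun_prop)
      simpa using this)
    hG.convex_hypograph (by
      rw [Set.disjoint_left]
      rintro ⟨ξ, r⟩ ⟨_, ha⟩ ⟨_, hb⟩
      have := h ξ
      simp only at ha hb
      linarith)
  have hf : ∀ ξ r, f (ξ, r) = f (ξ, 0) + r * f (0, 1) := by
    intro ξ r
    have : ((ξ, r) : EuclideanSpace ℝ (Fin d) × ℝ) = (ξ, 0) + r • (0, 1) := by simp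
    rw [this, map_add, map_smul, smul_eq_mul]
  set β := f (0, 1) with hβ
  have h1' : ∀ ξ r, F ξ < r → f (ξ, 0) + r * β < v := fun ξ r hr => by
    rw [← hf]; exact h1 _ ⟨trivial, hr⟩
  have h2' : ∀ ξ, v ≤ f (ξ, 0) + G ξ * β := fun ξ => by
    rw [← hf]; exact h2 _ ⟨trivial, le_rfl⟩
  have hβneg : β < 0 := by
    have a := h1' 0 (F 0 + 1) (by linarith)
    have b := h2' 0
    have c := h 0
    by_contra hn
    push Not at hn
    nlinarith
  let l : StrongDual ℝ (EuclideanSpace ℝ (Fin d)) :=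
    (-β⁻¹) • f.comp (ContinuousLinearMap.inl ℝ _ ℝ)
  refine ⟨(InnerProductSpace.toDual ℝ _).symm l, v / β, fun ξ => ?_⟩
  rw [InnerProductSpace.toDual_symm_apply]
  have hl : l ξ + v / β = (v - f (ξ, 0)) / β := by
    simp [l]; field_simp; ring
  rw [hl]
  constructor
  · rw [le_div_iff_of_neg hβneg]
    linarith [h2' ξ]
  · refine le_of_forall_gt_imp_ge_of_dense fun r hr => ?_
    rw [div_le_iff_of_neg hβneg]
    linarith [h1' ξ r hr]

lemma split {F G : EuclideanSpace ℝ (Fin d) → ℝ} (hF : ConvexOn ℝ Set.univ F)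
    (hG : ConvexOn ℝ Set.univ G) (hS : SL (fun ξ => F ξ + G ξ)) (z : EuclideanSpace ℝ (Fin d)) :
    ∃ u, legendreConj F u + legendreConj G (z - u) ≤ legendreConj (fun ξ => F ξ + G ξ) z := by
  set M := legendreConj (fun ξ => F ξ + G ξ) z with hM
  have hcv : ConcaveOn ℝ Set.univ (fun ξ => ⟪z, ξ⟫ - G ξ - M) := by
    refine ⟨convex_univ, fun p _ q _ a b ha hb hab => ?_⟩
    have := hG.2 (Set.mem_univ p) (Set.mem_univ q) ha hb hab
    simp only [inner_add_right, inner_smul_right, smul_eq_mul] at this ⊢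
    have : M = a * M + b * M := by rw [← add_mul, hab, one_mul]
    linarith
  obtain ⟨u, c, huc⟩ := sandwich hF hcv (fun ξ => by
    have := le_conj hS z ξ
    linarith)
  refine ⟨u, ?_⟩
  have h1 : legendreConj F u ≤ -c := ciSup_le fun y => by linarith [(huc y).2]
  have h2 : legendreConj G (z - u) ≤ M + c := ciSup_le fun y => by
    rw [inner_sub_left]; linarith [(huc y).1]
  linarith

lemma conj_add_le {F G : EuclideanSpace ℝ (Fin d) → ℝ} (hF : SL F) (hG : SL G)
    (p q : EuclideanSpace ℝ (Fin d)) :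
    legendreConj (fun ξ => F ξ + G ξ) (p + q) ≤ legendreConj F p + legendreConj G q :=
  ciSup_le fun y => by
    rw [inner_add_left]; linarith [le_conj hF p y, le_conj hG q y]

lemma cvx_comb {F G : EuclideanSpace ℝ (Fin d) → ℝ} (hF : ConvexOn ℝ Set.univ F)
    (hG : ConvexOn ℝ Set.univ G) {a b : ℝ} (ha : 0 ≤ a) (hb : 0 ≤ b) :
    ConvexOn ℝ Set.univ (fun ξ => a * F ξ + b * G ξ) :=
  (hF.smul ha).add (hG.smul hb)

end LaxAux

/-- Semigroup property of the multi-time Lax formula: for `0 ≤ s₁ < t₁`, `0 ≤ s₂ < t₂` and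
all `x`, `w(t₁,t₂,x) = min_y { ((t₁-s₁)H₁ + (t₂-s₂)H₂)*(x - y) + w(s₁,s₂,y) }`,
the minimum being attained. -/
theorem lax_semigroup (d : ℕ) (H₁ H₂ g : EuclideanSpace ℝ (Fin d) → ℝ)
    (hH₁ : ConvexOn ℝ Set.univ H₁) (hH₂ : ConvexOn ℝ Set.univ H₂)
    (hH₁coer : Coercive H₁) (hH₂coer : Coercive H₂)
    (K : NNReal) (hg : LipschitzWith K g)
    (s₁ s₂ t₁ t₂ : ℝ) (hs₁ : 0 ≤ s₁) (hst₁ : s₁ < t₁) (hs₂ : 0 ≤ s₂) (hst₂ : s₂ < t₂)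
    (x : EuclideanSpace ℝ (Fin d)) :
    lax H₁ H₂ g t₁ t₂ x
      = ⨅ y, (legendreConj (fun ξ => (t₁ - s₁) * H₁ ξ + (t₂ - s₂) * H₂ ξ) (x - y)
          + lax H₁ H₂ g s₁ s₂ y) ∧
    ∃ y : EuclideanSpace ℝ (Fin d),
      lax H₁ H₂ g t₁ t₂ x
        = legendreConj (fun ξ => (t₁ - s₁) * H₁ ξ + (t₂ - s₂) * H₂ ξ) (x - y)
          + lax H₁ H₂ g s₁ s₂ y := by
  suffices H : (∀ y, lax H₁ H₂ g t₁ t₂ x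
      ≤ legendreConj (fun ξ => (t₁ - s₁) * H₁ ξ + (t₂ - s₂) * H₂ ξ) (x - y)
          + lax H₁ H₂ g s₁ s₂ y) ∧ ∃ y : EuclideanSpace ℝ (Fin d),
      legendreConj (fun ξ => (t₁ - s₁) * H₁ ξ + (t₂ - s₂) * H₂ ξ) (x - y)
          + lax H₁ H₂ g s₁ s₂ y ≤ lax H₁ H₂ g t₁ t₂ x by
    obtain ⟨h1, y, hy⟩ := H
    refine ⟨le_antisymm (le_ciInf h1) ?_, y, le_antisymm (h1 y) hy⟩
    exact (ciInf_le ⟨_, by rintro _ ⟨y, rfl⟩; exact h1 y⟩ y).trans hy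
  have hS₁ := LaxAux.SL_of_coercive (LaxAux.cvx_cont hH₁) hH₁coer
  have hS₂ := LaxAux.SL_of_coercive (LaxAux.cvx_cont hH₂) hH₂coer
  have ht : ¬ (t₁ = 0 ∧ t₂ = 0) := fun h => by linarith [h.1]
  have hST := LaxAux.SL_comb' hS₁ hS₂ (hs₁.trans hst₁.le) (hs₂.trans hst₂.le) ht
  have hCT := LaxAux.cvx_comb hH₁ hH₂ (hs₁.trans hst₁.le) (hs₂.trans hst₂.le)
  have hSG := LaxAux.SL_comb hS₁ hS₂ (sub_pos.2 hst₁) (sub_pos.2 hst₂).le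
  have hCG := LaxAux.cvx_comb hH₁ hH₂ (sub_pos.2 hst₁).le (sub_pos.2 hst₂).le
  obtain ⟨y₀, hy₀⟩ := LaxAux.attain hST (LaxAux.cvx_cont hCT) hg x
  have hlt : ∀ y, lax H₁ H₂ g t₁ t₂ x
      ≤ legendreConj (fun ξ => t₁ * H₁ ξ + t₂ * H₂ ξ) (x - y) + g y := fun y => by
    rw [lax, if_neg ht]
    exact ciInf_le ⟨_, by rintro _ ⟨y, rfl⟩; exact hy₀ y⟩ y
  have hge : legendreConj (fun ξ => t₁ * H₁ ξ + t₂ * H₂ ξ) (x - y₀) + g y₀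
      ≤ lax H₁ H₂ g t₁ t₂ x := by
    rw [lax, if_neg ht]
    exact le_ciInf hy₀
  by_cases hs : s₁ = 0 ∧ s₂ = 0
  · obtain ⟨rfl, rfl⟩ := hs
    simp only [sub_zero]
    have h0 : ∀ y, lax H₁ H₂ g 0 0 y = g y := fun y => by simp [lax]
    simp only [h0]
    exact ⟨hlt, y₀, hge⟩
  · have hSF := LaxAux.SL_comb' hS₁ hS₂ hs₁ hs₂ hs
    have hCF := LaxAux.cvx_comb hH₁ hH₂ hs₁ hs₂
    have hsum : (fun ξ => t₁ * H₁ ξ + t₂ * H₂ ξ) = fun ξ =>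
        (s₁ * H₁ ξ + s₂ * H₂ ξ) + ((t₁ - s₁) * H₁ ξ + (t₂ - s₂) * H₂ ξ) := by
      funext ξ; ring
    rw [hsum] at hlt hge hST
    constructor
    · intro y
      rw [← sub_le_iff_le_add']
      conv_rhs => rw [lax, if_neg hs]
      refine le_ciInf fun z => ?_
      have h1 := hlt z
      have h2 := LaxAux.conj_add_le hSF hSG (y - z) (x - y)
      rw [show y - z + (x - y) = x - z by abel] at h2
      linarith
    · obtain ⟨u, hu⟩ := LaxAux.split hCF hCG hST (x - y₀)
      refine ⟨y₀ + u, ?_⟩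
      obtain ⟨z₀, hz₀⟩ := LaxAux.attain hSF (LaxAux.cvx_cont hCF) hg (y₀ + u)
      have h1 : lax H₁ H₂ g s₁ s₂ (y₀ + u) ≤
          legendreConj (fun ξ => s₁ * H₁ ξ + s₂ * H₂ ξ) (y₀ + u - y₀) + g y₀ := by
        rw [lax, if_neg hs]
        exact ciInf_le ⟨_, by rintro _ ⟨y, rfl⟩; exact hz₀ y⟩ y₀
      rw [add_sub_cancel_left] at h1
      rw [sub_sub] at hu
      linarith
end

section
/- The function w defined by the multi-time Lax formula, extended by w(0,0,x) = g(x), is Lipschitz continuous on [0,∞)² × ℝ^d (jointly in the two time variables and the space variable). -/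
open Filter Topology
open scoped RealInnerProductSpace

lemma lower_lin {d : ℕ} {H : EuclideanSpace ℝ (Fin d) → ℝ} (hc : Continuous H) (hco : Coercive H)
    (A : ℝ) : ∃ B : ℝ, ∀ y, A * ‖y‖ - B ≤ H y := by
  have h1 := hco.eventually (eventually_ge_atTop A)
  rw [Filter.eventually_comap, Filter.eventually_atTop] at h1
  obtain ⟨R, hR⟩ := h1
  obtain ⟨B, hB⟩ := (isCompact_closedBall (0 : EuclideanSpace ℝ (Fin d)) (max R 1)).bddAbove_image
    (f := fun y => A * ‖y‖ - H y) (by fun_prop)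
  refine ⟨max B 0, fun y => ?_⟩
  by_cases hy : ‖y‖ ≤ max R 1
  · have := hB (Set.mem_image_of_mem _ (show y ∈ Metric.closedBall 0 (max R 1) by simpa using hy))
    have h2 := le_max_left B 0
    linarith
  · push Not at hy
    have h2 := hR ‖y‖ ((le_max_left _ _).trans hy.le) y rfl
    have h3 : 0 < ‖y‖ := lt_of_lt_of_le one_pos ((le_max_right _ _).trans hy.le)
    rw [le_div_iff₀ h3] at h2
    have := le_max_right B 0
    linarith

lemma sep {d : ℕ} {ψ : EuclideanSpace ℝ (Fin d) → ℝ} (hψ : ConvexOn ℝ Set.univ ψ)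
    (hc : Continuous ψ) {K : ℝ} (hK : 0 ≤ K) (h0 : ∀ y, ‖y‖ ≤ K → 0 ≤ ψ y) :
    ∃ p : EuclideanSpace ℝ (Fin d), ∀ y, ⟪p, y⟫ + K * ‖p‖ ≤ ψ y := by
  have hconv : Convex ℝ {q : EuclideanSpace ℝ (Fin d) × ℝ | ψ q.1 < q.2} := by
    simpa using hψ.convex_strict_epigraph
  have hopen : IsOpen {q : EuclideanSpace ℝ (Fin d) × ℝ | ψ q.1 < q.2} :=
    isOpen_lt (by fun_prop) (by fun_prop)
  have hconv2 : Convex ℝ (Metric.closedBall (0 : EuclideanSpace ℝ (Fin d)) K ×ˢ ({0} : Set ℝ)) :=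
    (convex_closedBall _ _).prod (convex_singleton _)
  have hdis : Disjoint {q : EuclideanSpace ℝ (Fin d) × ℝ | ψ q.1 < q.2}
      (Metric.closedBall (0 : EuclideanSpace ℝ (Fin d)) K ×ˢ ({0} : Set ℝ)) := by
    rw [Set.disjoint_left]
    rintro ⟨y, r⟩ h1 ⟨h2, h3⟩
    simp at h1 h2 h3
    have := h0 y h2
    linarith
  obtain ⟨f, u, hf1, hf2⟩ := geometric_hahn_banach_open hconv hopen hconv2 hdis
  set c := f (0, 1) with hcdef
  set l : StrongDual ℝ (EuclideanSpace ℝ (Fin d)) :=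
    f.comp (ContinuousLinearMap.inl ℝ _ ℝ) with hl
  have hfe : ∀ y r, f (y, r) = l y + r * c := by
    intro y r
    have : ((y, r) : EuclideanSpace ℝ (Fin d) × ℝ) = (y, 0) + r • (0, 1) := by simp
    rw [this, map_add, map_smul]
    simp [hl, hcdef]
  have H1 : ∀ y r, ψ y < r → l y + r * c < u := fun y r h => by
    rw [← hfe]; exact hf1 _ h
  have H2 : ∀ b, ‖b‖ ≤ K → u ≤ l b := fun b hb => by
    have := hf2 (b, 0) ⟨by simpa using hb, rfl⟩
    rw [hfe] at this; simpa using this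
  have hu : u ≤ 0 := by simpa using H2 0 (by simpa using hK)
  have hcneg : c < 0 := by
    have := H1 0 (|ψ 0| + 1) (by linarith [le_abs_self (ψ 0)])
    simp only [map_zero, zero_add] at this
    by_contra hcc
    push Not at hcc
    have h3 : 0 ≤ (|ψ 0| + 1) * c := by positivity
    linarith
  have H3 : ∀ y b, ‖b‖ ≤ K → l y + ψ y * c ≤ l b := by
    intro y b hb
    refine le_of_forall_pos_le_add fun ε hε => ?_
    have h4 := H1 y (ψ y + ε / (-c)) (by have : 0 < ε / (-c) := div_pos hε (by linarith)
                                         linarith)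
    have h5 := H2 b hb
    have h6 : ε / (-c) * c = -ε := by field_simp [hcneg.ne]
    rw [add_mul, h6] at h4
    linarith
  set q := (InnerProductSpace.toDual ℝ (EuclideanSpace ℝ (Fin d))).symm l with hq
  have hlq : ∀ y, l y = ⟪q, y⟫ := fun y => by simp [hq]
  refine ⟨(-c)⁻¹ • q, fun y => ?_⟩
  have hcp : 0 < -c := by linarith
  have key : ⟪q, y⟫ + ψ y * c ≤ - (K * ‖q‖) := by
    by_cases hq0 : ‖q‖ = 0
    · have := H3 y 0 (by simpa using hK)
      rw [hlq, hlq] at this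
      simpa [hq0] using this
    · have hqp : 0 < ‖q‖ := lt_of_le_of_ne (norm_nonneg _) (Ne.symm hq0)
      have := H3 y (-(K / ‖q‖) • q) (by
        rw [norm_smul, norm_neg, Real.norm_of_nonneg (by positivity)]
        field_simp; rfl)
      rw [hlq, hlq, inner_smul_right, real_inner_self_eq_norm_sq] at this
      have h7 : -(K / ‖q‖) * ‖q‖ ^ 2 = -(K * ‖q‖) := by field_simp
      linarith
  rw [real_inner_smul_left, norm_smul, Real.norm_of_nonneg (by positivity)]
  have : (-c)⁻¹ * ⟪q, y⟫ + K * ((-c)⁻¹ * ‖q‖) = (-c)⁻¹ * (⟪q, y⟫ + K * ‖q‖) := by ring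
  rw [this, inv_mul_le_iff₀ hcp]
  linarith

/-- the conjugate is finite -/
def FinConj {d : ℕ} (F : EuclideanSpace ℝ (Fin d) → ℝ) : Prop :=
  ∀ p, BddAbove (Set.range fun y => ⟪p, y⟫ - F y)

/-- Lax operator -/
noncomputable def WW {d : ℕ} (F g : EuclideanSpace ℝ (Fin d) → ℝ)
    (x : EuclideanSpace ℝ (Fin d)) : ℝ := ⨅ y, (legendreConj F (x - y) + g y)

section
variable {d : ℕ} {F G g : EuclideanSpace ℝ (Fin d) → ℝ} {K : NNReal}

lemma le_conj (hF : FinConj F) (p y : EuclideanSpace ℝ (Fin d)) :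
    ⟪p, y⟫ - F y ≤ legendreConj F p := le_ciSup (hF p) y

lemma g_le (hg : LipschitzWith K g) (x y : EuclideanSpace ℝ (Fin d)) :
    g x ≤ g y + K * ‖x - y‖ := by
  have := hg.dist_le_mul x y
  rw [Real.dist_eq, dist_eq_norm] at this
  linarith [le_abs_self (g x - g y)]

lemma low_pt (hF : FinConj F) (hg : LipschitzWith K g) {a : ℝ} (ha : ∀ y, ‖y‖ ≤ K → F y ≤ a)
    (x y : EuclideanSpace ℝ (Fin d)) : g x ≤ legendreConj F (x - y) + g y + a := by
  have h1 := g_le hg x y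
  by_cases h : ‖x - y‖ = 0
  · have h2 := le_conj hF (x - y) 0
    have h3 := ha 0 (by simp)
    simp only [inner_zero_right, h, mul_zero] at h1 h2
    linarith
  · have hp : 0 < ‖x - y‖ := lt_of_le_of_ne (norm_nonneg _) (Ne.symm h)
    have h2 := le_conj hF (x - y) ((K / ‖x - y‖) • (x - y))
    have h3 := ha ((K / ‖x - y‖) • (x - y)) (by
      rw [norm_smul, Real.norm_of_nonneg (by positivity)]
      field_simp; rfl)
    rw [inner_smul_right, real_inner_self_eq_norm_sq] at h2
    have h7 : (K / ‖x - y‖) * ‖x - y‖ ^ 2 = K * ‖x - y‖ := by field_simp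
    linarith

lemma bdd_ball (hc : Continuous F) (r : ℝ) : ∃ a, ∀ y, ‖y‖ ≤ r → F y ≤ a := by
  obtain ⟨B, hB⟩ := (isCompact_closedBall (0 : EuclideanSpace ℝ (Fin d)) r).bddAbove_image
    (f := F) hc.continuousOn
  exact ⟨B, fun y hy => hB (Set.mem_image_of_mem _ (by simpa using hy))⟩

lemma bddB (hF : FinConj F) (hc : Continuous F) (hg : LipschitzWith K g)
    (x : EuclideanSpace ℝ (Fin d)) :
    BddBelow (Set.range fun y => legendreConj F (x - y) + g y) := by
  obtain ⟨a, ha⟩ := bdd_ball hc K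
  refine ⟨g x - a, ?_⟩
  rintro _ ⟨y, rfl⟩
  have := low_pt hF hg ha x y
  simp only
  linarith

lemma WW_le (hF : FinConj F) (hc : Continuous F) (hg : LipschitzWith K g)
    (x y : EuclideanSpace ℝ (Fin d)) : WW F g x ≤ legendreConj F (x - y) + g y :=
  ciInf_le (bddB hF hc hg x) y

lemma W_space (hF : FinConj F) (hc : Continuous F) (hg : LipschitzWith K g)
    (x x' : EuclideanSpace ℝ (Fin d)) : WW F g x ≤ WW F g x' + K * ‖x - x'‖ := by
  rw [← sub_le_iff_le_add]
  refine le_ciInf fun y => ?_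
  have h1 := WW_le hF hc hg x (y + (x - x'))
  have h2 := g_le hg (y + (x - x')) y
  rw [show x - (y + (x - x')) = x' - y by abel] at h1
  rw [add_sub_cancel_left] at h2
  linarith

lemma W_up (hF : FinConj F) (hG : FinConj G) (hcG : Continuous G)
    (hg : LipschitzWith K g) {b : ℝ} (h : ∀ y, F y ≤ G y + b)
    (x : EuclideanSpace ℝ (Fin d)) : WW G g x ≤ WW F g x + b := by
  rw [← sub_le_iff_le_add]
  refine le_ciInf fun y => ?_
  have h1 := WW_le hG hcG hg x y
  have h2 : legendreConj G (x - y) ≤ legendreConj F (x - y) + b := by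
    refine ciSup_le fun z => ?_
    have := le_conj hF (x - y) z
    linarith [h z]
  linarith

lemma W_low (hF : FinConj F) (hcF : Continuous F) (hFc : ConvexOn ℝ Set.univ F) (hG : FinConj G)
    (hg : LipschitzWith K g) {a : ℝ} (h : ∀ y, ‖y‖ ≤ K → G y ≤ F y + a)
    (x : EuclideanSpace ℝ (Fin d)) : WW F g x ≤ WW G g x + a := by
  rw [← sub_le_iff_le_add]
  refine le_ciInf fun y => ?_
  set z := x - y with hz
  set m := legendreConj G z + a with hm
  have hlin : ConvexOn ℝ Set.univ (fun v : EuclideanSpace ℝ (Fin d) => m - ⟪z, v⟫) := by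
    refine ⟨convex_univ, fun u _ v _ s t _ _ hst => le_of_eq ?_⟩
    simp only [inner_add_right, inner_smul_right, smul_eq_mul]
    have : m = (s + t) * m := by rw [hst, one_mul]
    linarith
  obtain ⟨p, hp⟩ := sep (hFc.add hlin) (by fun_prop) K.2 (fun v hv => by
    have h1 := le_conj hG z v
    have h2 := h v hv
    simp only [Pi.add_apply]
    linarith)
  have h1 := WW_le hF hcF hg x (y - p)
  have h2 := g_le hg (y - p) y
  have h3 : legendreConj F (x - (y - p)) ≤ m - K * ‖p‖ := by
    refine ciSup_le fun v => ?_
    have := hp v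
    rw [show x - (y - p) = z + p by rw [hz]; abel, inner_add_left]
    simp only [Pi.add_apply] at this
    change _ + (K : ℝ) * _ ≤ _ at this
    linarith
  rw [show y - p - y = -p by abel, norm_neg] at h2
  linarith

lemma W_up0 (hG : FinConj G) (hcG : Continuous G)
    (hg : LipschitzWith K g) {b : ℝ} (h : ∀ y, 0 ≤ G y + b)
    (x : EuclideanSpace ℝ (Fin d)) : WW G g x ≤ g x + b := by
  have h1 := WW_le hG hcG hg x x
  have h2 : legendreConj G (x - x) ≤ b := by
    refine ciSup_le fun z => ?_
    simp only [sub_self, inner_zero_left]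
    linarith [h z]
  linarith

lemma W_low0 (hG : FinConj G) (hg : LipschitzWith K g) {a : ℝ} (h : ∀ y, ‖y‖ ≤ K → G y ≤ a)
    (x : EuclideanSpace ℝ (Fin d)) : g x ≤ WW G g x + a := by
  rw [← sub_le_iff_le_add]
  refine le_ciInf fun y => ?_
  linarith [low_pt hG hg h x y]

lemma finConj_comb {H₁ H₂ : EuclideanSpace ℝ (Fin d) → ℝ} (hc₁ : Continuous H₁)
    (hc₂ : Continuous H₂) (h₁ : Coercive H₁) (h₂ : Coercive H₂) {s t : ℝ} (hs : 0 < s)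
    (ht : 0 ≤ t) : FinConj (fun ξ => s * H₁ ξ + t * H₂ ξ) := by
  intro p
  obtain ⟨B, hB⟩ := lower_lin hc₁ h₁ (‖p‖ / s)
  obtain ⟨B', hB'⟩ := lower_lin hc₂ h₂ 0
  refine ⟨s * B + t * B', ?_⟩
  rintro _ ⟨y, rfl⟩
  have h1 := mul_le_mul_of_nonneg_left (hB y) hs.le
  have h2 := mul_le_mul_of_nonneg_left (hB' y) ht
  have h3 := real_inner_le_norm p y
  have h4 : s * (‖p‖ / s * ‖y‖ - B) = ‖p‖ * ‖y‖ - s * B := by field_simp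
  simp only
  linarith

end

/-- The function `w` given by the multi-time Lax formula (extended by `w(0,0,·) = g`) is
jointly Lipschitz continuous on `[0,∞)² × ℝ^d`. -/
theorem lax_jointly_lipschitz (d : ℕ) (H₁ H₂ g : EuclideanSpace ℝ (Fin d) → ℝ)
    (hH₁ : ConvexOn ℝ Set.univ H₁) (hH₂ : ConvexOn ℝ Set.univ H₂)
    (hH₁coer : Coercive H₁) (hH₂coer : Coercive H₂)
    (K : NNReal) (hg : LipschitzWith K g) :
    ∃ L : NNReal,
      LipschitzOnWith L (fun p : ℝ × ℝ × EuclideanSpace ℝ (Fin d) => lax H₁ H₂ g p.1 p.2.1 p.2.2)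
        {p : ℝ × ℝ × EuclideanSpace ℝ (Fin d) | 0 ≤ p.1 ∧ 0 ≤ p.2.1} := by
  have hc₁ : Continuous H₁ := by
    rw [← continuousOn_univ]; exact ConvexOn.continuousOn isOpen_univ hH₁
  have hc₂ : Continuous H₂ := by
    rw [← continuousOn_univ]; exact ConvexOn.continuousOn isOpen_univ hH₂
  obtain ⟨a₁, ha₁⟩ := bdd_ball hc₁ K
  obtain ⟨a₂, ha₂⟩ := bdd_ball hc₂ K
  obtain ⟨b₁, hb₁⟩ := lower_lin hc₁ hH₁coer 0
  obtain ⟨b₂, hb₂⟩ := lower_lin hc₂ hH₂coer 0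
  obtain ⟨C, hC⟩ : ∃ C : ℝ, 0 ≤ C ∧ a₁ ≤ C ∧ a₂ ≤ C ∧ b₁ ≤ C ∧ b₂ ≤ C :=
    ⟨|a₁| + |a₂| + |b₁| + |b₂|, by positivity, by
      have := le_abs_self a₁; have := le_abs_self a₂; have := le_abs_self b₁
      have := le_abs_self b₂; have := abs_nonneg a₁; have := abs_nonneg a₂
      have := abs_nonneg b₁; have := abs_nonneg b₂
      refine ⟨?_, ?_, ?_, ?_⟩ <;> linarith⟩
  obtain ⟨hC0, hC1, hC2, hC3, hC4⟩ := hC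
  have hup₁ : ∀ y, ‖y‖ ≤ K → H₁ y ≤ C := fun y hy => (ha₁ y hy).trans hC1
  have hup₂ : ∀ y, ‖y‖ ≤ K → H₂ y ≤ C := fun y hy => (ha₂ y hy).trans hC2
  have hlo₁ : ∀ y, 0 ≤ H₁ y + C := fun y => by have := hb₁ y; linarith
  have hlo₂ : ∀ y, 0 ≤ H₂ y + C := fun y => by have := hb₂ y; linarith
  have hfin : ∀ s t : ℝ, 0 ≤ s → 0 ≤ t → ¬ (s = 0 ∧ t = 0) →
      FinConj (fun ξ => s * H₁ ξ + t * H₂ ξ) := by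
    intro s t hs ht h
    rcases hs.lt_or_eq with h1 | h1
    · exact finConj_comb hc₁ hc₂ hH₁coer hH₂coer h1 ht
    · rcases ht.lt_or_eq with h2 | h2
      · have := finConj_comb hc₂ hc₁ hH₂coer hH₁coer h2 hs
        simpa only [add_comm] using this
      · exact absurd ⟨h1.symm, h2.symm⟩ h
  have hcon : ∀ s t : ℝ, Continuous (fun ξ => s * H₁ ξ + t * H₂ ξ) := fun s t => by fun_prop
  have hconv : ∀ s t : ℝ, 0 ≤ s → 0 ≤ t →
      ConvexOn ℝ Set.univ (fun ξ => s * H₁ ξ + t * H₂ ξ) := fun s t hs ht => by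
    exact (hH₁.smul hs).add (hH₂.smul ht)
  have hw0 : ∀ x, lax H₁ H₂ g 0 0 x = g x := fun x => by simp [lax]
  have hw : ∀ s t x, ¬ (s = 0 ∧ t = 0) →
      lax H₁ H₂ g s t x = WW (fun ξ => s * H₁ ξ + t * H₂ ξ) g x := fun s t x h => by
    simp only [lax, if_neg h, WW]
  have hspace : ∀ s t x x', 0 ≤ s → 0 ≤ t →
      lax H₁ H₂ g s t x ≤ lax H₁ H₂ g s t x' + K * ‖x - x'‖ := by
    intro s t x x' hs ht
    by_cases h : s = 0 ∧ t = 0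
    · rw [h.1, h.2, hw0, hw0]; exact g_le hg x x'
    · rw [hw _ _ _ h, hw _ _ _ h]
      exact W_space (hfin s t hs ht h) (hcon s t) hg x x'
  have htime : ∀ s t S T x, 0 ≤ s → 0 ≤ t → s ≤ S → t ≤ T →
      lax H₁ H₂ g s t x ≤ lax H₁ H₂ g S T x + C * ((S - s) + (T - t)) ∧
      lax H₁ H₂ g S T x ≤ lax H₁ H₂ g s t x + C * ((S - s) + (T - t)) := by
    intro s t S T x hs ht hS hT
    have e1 : ∀ y, ‖y‖ ≤ K → S * H₁ y + T * H₂ y ≤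
        s * H₁ y + t * H₂ y + C * ((S - s) + (T - t)) := fun y hy => by
      have h1 := mul_le_mul_of_nonneg_left (hup₁ y hy) (sub_nonneg.2 hS)
      have h2 := mul_le_mul_of_nonneg_left (hup₂ y hy) (sub_nonneg.2 hT)
      linarith
    have e2 : ∀ y, s * H₁ y + t * H₂ y ≤
        S * H₁ y + T * H₂ y + C * ((S - s) + (T - t)) := fun y => by
      have h1 := mul_nonneg (sub_nonneg.2 hS) (hlo₁ y)
      have h2 := mul_nonneg (sub_nonneg.2 hT) (hlo₂ y)
      linarith
    by_cases h' : S = 0 ∧ T = 0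
    · have h1 : s = 0 := by linarith [h'.1]
      have h2 : t = 0 := by linarith [h'.2]
      simp [h1, h2, h'.1, h'.2]
    have f2 := hfin S T (hs.trans hS) (ht.trans hT) h'
    by_cases h : s = 0 ∧ t = 0
    · obtain ⟨rfl, rfl⟩ := h
      rw [hw0, hw _ _ _ h']
      exact ⟨W_low0 f2 hg (fun y hy => by simpa using e1 y hy) x,
        W_up0 f2 (hcon S T) hg (fun y => by simpa using e2 y) x⟩
    · have f1 := hfin s t hs ht h
      rw [hw _ _ _ h, hw _ _ _ h']
      exact ⟨W_low f1 (hcon s t) (hconv s t hs ht) f2 hg e1 x, W_up f1 f2 (hcon S T) hg e2 x⟩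
  have hall : ∀ s t s' t' x x', 0 ≤ s → 0 ≤ t → 0 ≤ s' → 0 ≤ t' →
      lax H₁ H₂ g s t x ≤ lax H₁ H₂ g s' t' x' + C * (|s - s'| + |t - t'|) + K * ‖x - x'‖ := by
    intro s t s' t' x x' hs ht hs' ht'
    have h1 := (htime s t (max s s') (max t t') x hs ht (le_max_left _ _) (le_max_left _ _)).1
    have h2 := (htime s' t' (max s s') (max t t') x hs' ht' (le_max_right _ _)
      (le_max_right _ _)).2
    have h3 := hspace s' t' x x' hs' ht'
    have h4 : (max s s' - s) + (max s s' - s') = |s - s'| := by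
      rcases le_total s s' with h | h
      · rw [max_eq_right h, abs_of_nonpos (by linarith)]; ring
      · rw [max_eq_left h, abs_of_nonneg (by linarith)]; ring
    have h5 : (max t t' - t) + (max t t' - t') = |t - t'| := by
      rcases le_total t t' with h | h
      · rw [max_eq_right h, abs_of_nonpos (by linarith)]; ring
      · rw [max_eq_left h, abs_of_nonneg (by linarith)]; ring
    rw [← h4, ← h5]
    linarith
  refine ⟨⟨2 * C + K, by positivity⟩, LipschitzOnWith.of_le_add_mul _ ?_⟩
  rintro ⟨s, t, x⟩ ⟨hs, ht⟩ ⟨s', t', x'⟩ ⟨hs', ht'⟩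
  have h1 := hall s t s' t' x x' hs ht hs' ht'
  set D := dist (s, t, x) (s', t', x') with hD
  have d1 : |s - s'| ≤ D := by rw [hD, Prod.dist_eq, ← Real.dist_eq]; exact le_max_left _ _
  have d2 : |t - t'| ≤ D := by
    rw [hD, Prod.dist_eq, Prod.dist_eq, ← Real.dist_eq]
    exact (le_max_left _ _).trans (le_max_right _ _)
  have d3 : ‖x - x'‖ ≤ D := by
    rw [hD, Prod.dist_eq, Prod.dist_eq, ← dist_eq_norm]
    exact (le_max_right _ _).trans (le_max_right _ _)
  have m1 := mul_le_mul_of_nonneg_left (add_le_add d1 d2) hC0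
  have m2 := mul_le_mul_of_nonneg_left d3 K.2
  change (K : ℝ) * _ ≤ (K : ℝ) * _ at m2
  change lax H₁ H₂ g s t x ≤ lax H₁ H₂ g s' t' x' + (2 * C + K) * D
  linarith
end

section
/- The function w given by the multi-time Lax formula is Lipschitz continuous on [0,∞)² × ℝ^d (with w(0,0,·) = g), is differentiable at Lebesgue-almost every point of (0,∞)² × ℝ^d, and solves the multi-time Hamilton–Jacobi initial-value problem: ∂_{t₁} w + H₁(Dw) = 0 and ∂_{t₂} w + H₂(Dw) = 0 at almost every point of (0,∞)² × ℝ^d, and w(0,0,x) = g(x) for all x ∈ ℝ^d. -/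
open Filter Topology MeasureTheory
open scoped RealInnerProductSpace

namespace LaxHJ

theorem sandwich {d : ℕ} {f : EuclideanSpace ℝ (Fin d) → ℝ} (hf : ConvexOn ℝ Set.univ f)
    (hc : Continuous f) {S : Set (EuclideanSpace ℝ (Fin d))} (hS : Convex ℝ S) (hne : S.Nonempty)
    (z : EuclideanSpace ℝ (Fin d)) (M : ℝ) (h : ∀ p ∈ S, ⟪z, p⟫ - M ≤ f p) :
    ∃ (v : EuclideanSpace ℝ (Fin d)) (c : ℝ), (∀ p, ⟪v, p⟫ + c ≤ f p) ∧
      ∀ p ∈ S, ⟪z, p⟫ - M ≤ ⟪v, p⟫ + c := by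
  have hA := hf.convex_strict_epigraph
  have hAo : IsOpen {p : EuclideanSpace ℝ (Fin d) × ℝ | p.1 ∈ Set.univ ∧ f p.1 < p.2} := by
    simp only [Set.mem_univ, true_and]
    exact isOpen_lt (by fun_prop) (by fun_prop)
  have hB : Convex ℝ {p : EuclideanSpace ℝ (Fin d) × ℝ | p.1 ∈ S ∧ p.2 ≤ ⟪z, p.1⟫ - M} := by
    rintro ⟨p, r⟩ ⟨hp, hr⟩ ⟨p', r'⟩ ⟨hp', hr'⟩ a b ha hb hab
    refine ⟨hS hp hp' ha hb hab, ?_⟩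
    simp only [Prod.smul_mk, Prod.mk_add_mk, smul_eq_mul, inner_add_right, inner_smul_right] at *
    have hM : M = a * M + b * M := by rw [← add_mul, hab, one_mul]
    nlinarith [mul_le_mul_of_nonneg_left hr ha, mul_le_mul_of_nonneg_left hr' hb]
  have hd : Disjoint {p : EuclideanSpace ℝ (Fin d) × ℝ | p.1 ∈ Set.univ ∧ f p.1 < p.2}
      {p : EuclideanSpace ℝ (Fin d) × ℝ | p.1 ∈ S ∧ p.2 ≤ ⟪z, p.1⟫ - M} := by
    rw [Set.disjoint_left]
    rintro ⟨p, r⟩ ⟨_, h1⟩ ⟨h2, h3⟩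
    have := h p h2
    simp only at h1 h3
    linarith
  obtain ⟨φ, u, h1, h2⟩ := geometric_hahn_banach_open hA hAo hB hd
  have hφ : ∀ p r, φ (p, r) = φ (p, 0) + r * φ (0, 1) := by
    intro p r
    have : ((p, r) : EuclideanSpace ℝ (Fin d) × ℝ) = (p, 0) + r • (0, 1) := by simp
    rw [this, map_add, map_smul, smul_eq_mul]
  set β := φ (0, 1) with hβ
  have hβ0 : β < 0 := by
    obtain ⟨p0, hp0⟩ := hne
    have e1 := h1 (p0, f p0 + 1) ⟨trivial, by simp⟩
    have e2 := h2 (p0, ⟪z, p0⟫ - M) ⟨hp0, le_rfl⟩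
    rw [hφ] at e1 e2
    have e3 := h p0 hp0
    by_contra hcon
    push Not at hcon
    nlinarith
  have h1' : ∀ p, φ (p, 0) + f p * β ≤ u := by
    intro p
    apply le_of_forall_pos_le_add
    intro ε hε
    have e1 := h1 (p, f p + ε / (-β)) ⟨trivial, by simpa using div_pos hε (neg_pos.2 hβ0)⟩
    rw [hφ] at e1
    have : ε / (-β) * β = -ε := by rw [div_neg, neg_mul, div_mul_cancel₀ _ hβ0.ne]
    nlinarith
  let ψ : StrongDual ℝ (EuclideanSpace ℝ (Fin d)) :=
    (-β⁻¹) • (φ.comp (ContinuousLinearMap.inl ℝ _ ℝ))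
  refine ⟨(InnerProductSpace.toDual ℝ _).symm ψ, u / β, ?_, ?_⟩
  · intro p
    rw [InnerProductSpace.toDual_symm_apply]
    have e : ψ p + u / β = (u - φ (p, 0)) / β := by
      simp [ψ]; ring
    rw [e, div_le_iff_of_neg hβ0]
    linarith [h1' p]
  · intro p hp
    rw [InnerProductSpace.toDual_symm_apply]
    have e : ψ p + u / β = (u - φ (p, 0)) / β := by
      simp [ψ]; ring
    rw [e, le_div_iff_of_neg hβ0]
    have e2 := h2 (p, ⟪z, p⟫ - M) ⟨hp, le_rfl⟩
    rw [hφ] at e2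
    linarith

theorem cont_of_convex {d : ℕ} {f : EuclideanSpace ℝ (Fin d) → ℝ} (hf : ConvexOn ℝ Set.univ f) :
    Continuous f := by
  rw [← continuousOn_univ]
  exact hf.continuousOn isOpen_univ

theorem coercive_bound {d : ℕ} {f : EuclideanSpace ℝ (Fin d) → ℝ} (hc : Continuous f)
    (h : Coercive f) (A : ℝ) : ∃ C, ∀ p, A * ‖p‖ - C ≤ f p := by
  have h1 := h.eventually (eventually_ge_atTop A)
  rw [eventually_comap] at h1
  obtain ⟨r, hr⟩ := eventually_atTop.1 h1
  have hcomp := isCompact_closedBall (0 : EuclideanSpace ℝ (Fin d)) (max r 1)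
  obtain ⟨C, hC⟩ := hcomp.exists_bound_of_continuousOn
    (f := fun p => A * ‖p‖ - f p) (by fun_prop)
  refine ⟨max C 0, fun p => ?_⟩
  by_cases hp : ‖p‖ ≤ max r 1
  · have := hC p (by simpa using hp)
    have := le_abs_self (A * ‖p‖ - f p)
    rw [Real.norm_eq_abs] at *
    have := le_max_left C 0
    linarith
  · push Not at hp
    have h1 : 1 < ‖p‖ := lt_of_le_of_lt (le_max_right _ _) hp
    have := hr ‖p‖ ((le_max_left _ _).trans hp.le) p rfl
    rw [le_div_iff₀ (by linarith)] at this
    have := le_max_right C 0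
    linarith

/-- truncated conjugate -/
noncomputable def Psi {d : ℕ} (H₁ H₂ : EuclideanSpace ℝ (Fin d) → ℝ) (R t₁ t₂ : ℝ)
    (z : EuclideanSpace ℝ (Fin d)) : ℝ :=
  ⨆ p : Metric.closedBall (0 : EuclideanSpace ℝ (Fin d)) R,
    (⟪z, (p : EuclideanSpace ℝ (Fin d))⟫ - (t₁ * H₁ p + t₂ * H₂ p))

noncomputable def GG {d : ℕ} (H₁ H₂ g : EuclideanSpace ℝ (Fin d) → ℝ) (R t₁ t₂ : ℝ)
    (x : EuclideanSpace ℝ (Fin d)) : ℝ :=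
  ⨅ y, (Psi H₁ H₂ R t₁ t₂ (x - y) + g y)

section
variable {d : ℕ} {H₁ H₂ g : EuclideanSpace ℝ (Fin d) → ℝ} {R C : ℝ}

theorem le_Psi (h1 : Continuous H₁) (h2 : Continuous H₂) (t₁ t₂ : ℝ)
    (z p : EuclideanSpace ℝ (Fin d)) (hp : ‖p‖ ≤ R) :
    ⟪z, p⟫ - (t₁ * H₁ p + t₂ * H₂ p) ≤ Psi H₁ H₂ R t₁ t₂ z := by
  have hcomp := isCompact_closedBall (0 : EuclideanSpace ℝ (Fin d)) R
  obtain ⟨C, hC⟩ := hcomp.exists_bound_of_continuousOn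
    (f := fun p => ⟪z, p⟫ - (t₁ * H₁ p + t₂ * H₂ p)) (by fun_prop)
  refine le_ciSup (f := fun p : Metric.closedBall (0 : EuclideanSpace ℝ (Fin d)) R =>
    (⟪z, (p : EuclideanSpace ℝ (Fin d))⟫ - (t₁ * H₁ p + t₂ * H₂ p))) ⟨C, ?_⟩ ⟨p, by simpa using hp⟩
  rintro _ ⟨q, rfl⟩
  exact (le_abs_self _).trans (hC q q.2)

theorem Psi_le (hR : 0 ≤ R) (t₁ t₂ : ℝ) (z : EuclideanSpace ℝ (Fin d)) (M : ℝ)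
    (h : ∀ p, ‖p‖ ≤ R → ⟪z, p⟫ - (t₁ * H₁ p + t₂ * H₂ p) ≤ M) :
    Psi H₁ H₂ R t₁ t₂ z ≤ M := by
  have : Nonempty (Metric.closedBall (0 : EuclideanSpace ℝ (Fin d)) R) := ⟨⟨0, by simpa using hR⟩⟩
  exact ciSup_le fun p => h p (mem_closedBall_zero_iff.1 p.2)

theorem Psi_lip (h1 : Continuous H₁) (h2 : Continuous H₂) (hR : 0 ≤ R)
    (hC1 : ∀ p, ‖p‖ ≤ R → |H₁ p| ≤ C) (hC2 : ∀ p, ‖p‖ ≤ R → |H₂ p| ≤ C)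
    (t₁ t₂ s₁ s₂ : ℝ) (z z' : EuclideanSpace ℝ (Fin d)) :
    Psi H₁ H₂ R s₁ s₂ z' ≤
      Psi H₁ H₂ R t₁ t₂ z + R * ‖z' - z‖ + C * |s₁ - t₁| + C * |s₂ - t₂| := by
  apply Psi_le hR
  intro p hp
  have e0 := le_Psi h1 h2 t₁ t₂ z p hp
  have e1 : ⟪z' - z, p⟫ ≤ R * ‖z' - z‖ :=
    (real_inner_le_norm _ _).trans (by rw [mul_comm]; gcongr)
  rw [inner_sub_left] at e1
  have e2 : -((s₁ - t₁) * H₁ p) ≤ C * |s₁ - t₁| := by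
    refine (neg_le_abs _).trans ?_
    rw [abs_mul, mul_comm]; gcongr; exact hC1 p hp
  have e3 : -((s₂ - t₂) * H₂ p) ≤ C * |s₂ - t₂| := by
    refine (neg_le_abs _).trans ?_
    rw [abs_mul, mul_comm]; gcongr; exact hC2 p hp
  linarith

theorem Psi_lower (h1 : Continuous H₁) (h2 : Continuous H₂) (hR : 0 ≤ R)
    (hC1 : ∀ p, ‖p‖ ≤ R → |H₁ p| ≤ C) (hC2 : ∀ p, ‖p‖ ≤ R → |H₂ p| ≤ C)
    (t₁ t₂ : ℝ) (z : EuclideanSpace ℝ (Fin d)) :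
    R * ‖z‖ - C * |t₁| - C * |t₂| ≤ Psi H₁ H₂ R t₁ t₂ z := by
  have e := Psi_lip h1 h2 hR hC1 hC2 t₁ t₂ 0 0 z z
  have : R * ‖z‖ ≤ Psi H₁ H₂ R 0 0 z := by
    by_cases hz : z = 0
    · subst hz
      have := le_Psi h1 h2 0 0 0 0 (by simpa using hR)
      simpa using this
    · have hz' : ‖z‖ ≠ 0 := norm_ne_zero_iff.2 hz
      have := le_Psi h1 h2 0 0 z ((R / ‖z‖) • z) (by
        rw [norm_smul, norm_div, norm_norm, Real.norm_of_nonneg hR, div_mul_cancel₀ _ hz'])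
      rw [inner_smul_right, real_inner_self_eq_norm_sq] at this
      have e : R / ‖z‖ * ‖z‖ ^ 2 = R * ‖z‖ := by field_simp
      linarith
  simp at e
  linarith

end

structure Hyp {d : ℕ} (H₁ H₂ g : EuclideanSpace ℝ (Fin d) → ℝ) (R C K : ℝ) : Prop where
  h1 : Continuous H₁
  h2 : Continuous H₂
  v1 : ConvexOn ℝ Set.univ H₁
  v2 : ConvexOn ℝ Set.univ H₂
  c1 : Coercive H₁
  c2 : Coercive H₂
  hR : 0 ≤ R
  hC1 : ∀ p, ‖p‖ ≤ R → |H₁ p| ≤ C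
  hC2 : ∀ p, ‖p‖ ≤ R → |H₂ p| ≤ C
  hRK : R = K + 1
  hg : ∀ x y, g x ≤ g y + K * ‖x - y‖

section
variable {d : ℕ} {H₁ H₂ g : EuclideanSpace ℝ (Fin d) → ℝ} {R C K : ℝ}

theorem Hyp.C_nonneg (h : Hyp H₁ H₂ g R C K) : 0 ≤ C :=
  (abs_nonneg _).trans (h.hC1 0 (by simpa using h.hR))

theorem Hyp.lower (h : Hyp H₁ H₂ g R C K) (t₁ t₂ : ℝ) (x y : EuclideanSpace ℝ (Fin d)) :
    ‖x - y‖ + (g x - C * |t₁| - C * |t₂|) ≤ Psi H₁ H₂ R t₁ t₂ (x - y) + g y := by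
  have e := Psi_lower h.h1 h.h2 h.hR h.hC1 h.hC2 t₁ t₂ (x - y)
  have e2 := h.hg x y
  rw [h.hRK] at *
  nlinarith

theorem Hyp.GG_le (h : Hyp H₁ H₂ g R C K) (t₁ t₂ : ℝ) (x y : EuclideanSpace ℝ (Fin d)) :
    GG H₁ H₂ g R t₁ t₂ x ≤ Psi H₁ H₂ R t₁ t₂ (x - y) + g y := by
  refine ciInf_le (f := fun y => Psi H₁ H₂ R t₁ t₂ (x - y) + g y)
    ⟨g x - C * |t₁| - C * |t₂|, ?_⟩ y
  rintro _ ⟨q, rfl⟩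
  have := h.lower t₁ t₂ x q
  have := norm_nonneg (x - q)
  simp only
  linarith

theorem Hyp.GG_lip (h : Hyp H₁ H₂ g R C K) (t₁ t₂ s₁ s₂ : ℝ) (x x' : EuclideanSpace ℝ (Fin d)) :
    GG H₁ H₂ g R s₁ s₂ x' ≤
      GG H₁ H₂ g R t₁ t₂ x + R * ‖x' - x‖ + C * |s₁ - t₁| + C * |s₂ - t₂| := by
  have : GG H₁ H₂ g R s₁ s₂ x' - (R * ‖x' - x‖ + C * |s₁ - t₁| + C * |s₂ - t₂|) ≤
      GG H₁ H₂ g R t₁ t₂ x := by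
    refine le_ciInf fun y => ?_
    have e1 := h.GG_le s₁ s₂ x' y
    have e2 := Psi_lip h.h1 h.h2 h.hR h.hC1 h.hC2 t₁ t₂ s₁ s₂ (x - y) (x' - y)
    rw [sub_sub_sub_cancel_right] at e2
    linarith
  linarith

theorem Hyp.GG_attained (h : Hyp H₁ H₂ g R C K) (hgc : Continuous g) (t₁ t₂ : ℝ)
    (x : EuclideanSpace ℝ (Fin d)) :
    ∃ y, GG H₁ H₂ g R t₁ t₂ x = Psi H₁ H₂ R t₁ t₂ (x - y) + g y := by
  have hP : Continuous (Psi H₁ H₂ R t₁ t₂) := by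
    have : LipschitzWith R.toNNReal (Psi H₁ H₂ R t₁ t₂) := by
      apply LipschitzWith.of_le_add_mul
      intro z' z
      have := Psi_lip h.h1 h.h2 h.hR h.hC1 h.hC2 t₁ t₂ t₁ t₂ z z'
      simp only [sub_self, abs_zero, mul_zero, add_zero] at this
      rwa [Real.coe_toNNReal _ h.hR, dist_eq_norm]
    exact this.continuous
  obtain ⟨y, hy⟩ := Continuous.exists_forall_le
    (f := fun y => Psi H₁ H₂ R t₁ t₂ (x - y) + g y) (by fun_prop) (by
      refine tendsto_atTop_mono (fun y => h.lower t₁ t₂ x y) ?_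
      apply tendsto_atTop_add_const_right
      have : Tendsto (fun y => ‖y‖ - ‖x‖) (cocompact (EuclideanSpace ℝ (Fin d))) atTop :=
        tendsto_atTop_add_const_right _ _ (tendsto_norm_cocompact_atTop)
      refine tendsto_atTop_mono (fun y => ?_) this
      rw [norm_sub_rev]
      exact norm_sub_norm_le y x)
  refine ⟨y, le_antisymm (h.GG_le t₁ t₂ x y) (le_ciInf hy)⟩

theorem Hyp.lax_eq (h : Hyp H₁ H₂ g R C K) (hK : 0 ≤ K) {t₁ t₂ : ℝ} (ht1 : 0 ≤ t₁) (ht2 : 0 ≤ t₂)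
    (x : EuclideanSpace ℝ (Fin d)) : lax H₁ H₂ g t₁ t₂ x = GG H₁ H₂ g R t₁ t₂ x := by
  unfold lax
  split_ifs with h0
  · obtain ⟨rfl, rfl⟩ := h0
    apply le_antisymm
    · refine le_ciInf fun y => ?_
      have := h.lower 0 0 x y
      simp at this
      linarith [norm_nonneg (x - y)]
    · refine (h.GG_le 0 0 x x).trans ?_
      have : Psi H₁ H₂ R 0 0 (x - x) ≤ 0 := Psi_le h.hR _ _ _ _ (by simp)
      linarith
  · have hpos : 0 < t₁ + t₂ := by
      rcases ht1.lt_or_eq with h' | h'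
      · linarith
      · rcases ht2.lt_or_eq with h'' | h''
        · linarith
        · exact absurd ⟨h'.symm, h''.symm⟩ h0
    have hle : ∀ z p, ⟪z, p⟫ - (t₁ * H₁ p + t₂ * H₂ p) ≤
        legendreConj (fun ξ => t₁ * H₁ ξ + t₂ * H₂ ξ) z := by
      intro z p
      obtain ⟨C1, hC1⟩ := coercive_bound h.h1 h.c1 (‖z‖ / (t₁ + t₂))
      obtain ⟨C2, hC2⟩ := coercive_bound h.h2 h.c2 (‖z‖ / (t₁ + t₂))
      refine le_ciSup (f := fun p => ⟪z, p⟫ - (t₁ * H₁ p + t₂ * H₂ p))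
        ⟨t₁ * C1 + t₂ * C2, ?_⟩ p
      rintro _ ⟨q, rfl⟩
      have e1 := mul_le_mul_of_nonneg_left (hC1 q) ht1
      have e2 := mul_le_mul_of_nonneg_left (hC2 q) ht2
      have e3 := real_inner_le_norm z q
      have e4 : (t₁ + t₂) * (‖z‖ / (t₁ + t₂) * ‖q‖) = ‖z‖ * ‖q‖ := by field_simp
      simp only
      linarith
    have hPle : ∀ z, Psi H₁ H₂ R t₁ t₂ z ≤ legendreConj (fun ξ => t₁ * H₁ ξ + t₂ * H₂ ξ) z :=
      fun z => Psi_le h.hR _ _ _ _ fun p _ => hle z p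
    apply le_antisymm
    · refine le_ciInf fun y => ?_
      have hconv : ConvexOn ℝ Set.univ (fun ξ => t₁ * H₁ ξ + t₂ * H₂ ξ) :=
        (h.v1.smul ht1).add (h.v2.smul ht2)
      obtain ⟨v, c, hv, hc⟩ := sandwich hconv (cont_of_convex hconv)
        (convex_closedBall (0 : EuclideanSpace ℝ (Fin d)) R) ⟨0, by simpa using h.hR⟩
        (x - y) (Psi H₁ H₂ R t₁ t₂ (x - y)) (by
          intro p hp
          have := le_Psi h.h1 h.h2 t₁ t₂ (x - y) p (mem_closedBall_zero_iff.1 hp)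
          linarith)
      have hleg : legendreConj (fun ξ => t₁ * H₁ ξ + t₂ * H₂ ξ) v ≤ -c := by
        refine ciSup_le fun p => ?_
        linarith [hv p]
      have hn : R * ‖x - y - v‖ ≤ c + Psi H₁ H₂ R t₁ t₂ (x - y) := by
        have e1 := Psi_lower (H₁ := fun _ => 0) (H₂ := fun _ => 0) (C := 0) continuous_const
          continuous_const h.hR (by simp) (by simp) 0 0 (x - y - v)
        have e2 : Psi (fun _ => 0) (fun _ => 0) R 0 0 (x - y - v) ≤
            c + Psi H₁ H₂ R t₁ t₂ (x - y) := by
          refine Psi_le h.hR _ _ _ _ fun p hp => ?_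
          have := hc p (by simpa using hp)
          rw [inner_sub_left _ v]
          linarith
        simp at e1
        linarith
      have e : (⨅ y, (legendreConj (fun ξ => t₁ * H₁ ξ + t₂ * H₂ ξ) (x - y) + g y)) ≤
          legendreConj (fun ξ => t₁ * H₁ ξ + t₂ * H₂ ξ) (x - (x - v)) + g (x - v) := by
        refine ciInf_le (f := fun y =>
          (legendreConj (fun ξ => t₁ * H₁ ξ + t₂ * H₂ ξ) (x - y) + g y))
          ⟨GG H₁ H₂ g R t₁ t₂ x, ?_⟩ (x - v)
        rintro _ ⟨q, rfl⟩
        have := h.GG_le t₁ t₂ x q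
        have := hPle (x - q)
        simp only
        linarith
      rw [sub_sub_cancel] at e
      have e3 := h.hg (x - v) y
      rw [sub_right_comm] at e3
      have e4 := norm_nonneg (x - y - v)
      rw [h.hRK] at hn
      rw [h.hRK] at *
      nlinarith
    · refine le_ciInf fun y => ?_
      exact (h.GG_le t₁ t₂ x y).trans (by linarith [hPle (x - y)])

theorem dir_le {F : Type*} [NormedAddCommGroup F] [NormedSpace ℝ F] {f : F → ℝ} {D : F →L[ℝ] ℝ}
    {p : F} (hf : HasFDerivAt f D p) (e : F) (m : ℝ)
    (h : ∀ s : ℝ, 0 < s → s ≤ 1 → f (p + s • e) ≤ f p + s * m) : D e ≤ m := by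
  have h1 : HasDerivAt (fun s : ℝ => f (p + s • e)) (D e) 0 := by
    have hl : HasDerivAt (fun s : ℝ => p + s • e) e 0 := by
      simpa using ((hasDerivAt_id (0 : ℝ)).smul_const e).const_add p
    have hf' : HasFDerivAt f D (p + (0 : ℝ) • e) := by simpa using hf
    exact hf'.comp_hasDerivAt (0 : ℝ) hl
  have h2 := h1.tendsto_slope_zero_right
  refine le_of_tendsto h2 ?_
  have : Set.Ioc (0 : ℝ) 1 ∈ 𝓝[>] (0 : ℝ) := Ioc_mem_nhdsGT one_pos
  filter_upwards [this] with s hs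
  have := h s hs.1 hs.2
  simp only [zero_add, zero_smul, add_zero, smul_eq_mul]
  rw [inv_mul_le_iff₀ hs.1]
  linarith

theorem Hyp.pde (h : Hyp H₁ H₂ g R C K) (hgc : Continuous g) {t₁ t₂ : ℝ} (ht1 : 0 < t₁)
    (ht2 : 0 < t₂) (x : EuclideanSpace ℝ (Fin d)) {D : ℝ × ℝ × EuclideanSpace ℝ (Fin d) →L[ℝ] ℝ}
    (hD : HasFDerivAt (fun q : ℝ × ℝ × EuclideanSpace ℝ (Fin d) => GG H₁ H₂ g R q.1 q.2.1 q.2.2) D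
      (t₁, t₂, x)) (q : EuclideanSpace ℝ (Fin d)) (hq : ∀ v, D (0, 0, v) = ⟪q, v⟫) :
    D (1, 0, 0) + H₁ q = 0 ∧ D (0, 1, 0) + H₂ q = 0 := by
  have hDe : ∀ a b v, D (a, b, v) = a * D (1, 0, 0) + b * D (0, 1, 0) + ⟪q, v⟫ := by
    intro a b v
    have : ((a, b, v) : ℝ × ℝ × EuclideanSpace ℝ (Fin d)) =
      a • (1, 0, 0) + b • (0, 1, 0) + (0, 0, v) := by simp
    rw [this, map_add, map_add, map_smul, map_smul, hq, smul_eq_mul, smul_eq_mul]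
  obtain ⟨y, hy⟩ := h.GG_attained hgc t₁ t₂ x
  have hqR : ‖q‖ ≤ R := by
    have := dir_le hD (0, 0, q) (R * ‖q‖) (by
      intro s hs _
      have := h.GG_lip t₁ t₂ t₁ t₂ x (x + s • q)
      simp [norm_smul, abs_of_pos hs] at this ⊢
      linarith)
    rw [hq, real_inner_self_eq_norm_sq] at this
    by_contra hcon
    push Not at hcon
    have := h.hR
    nlinarith
  have k1 : D (1, 0, 0) ≤ -H₁ q := by
    obtain ⟨v, c, hv, hc⟩ := sandwich h.v1 h.h1 (convex_singleton q) (Set.singleton_nonempty q)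
      0 (-H₁ q) (by simp)
    have hc := hc q rfl
    have := dir_le hD (1, 0, v) (-c) (by
      intro s hs _
      have e1 := h.GG_le (t₁ + s) t₂ (x + s • v) y
      have e2 : Psi H₁ H₂ R (t₁ + s) t₂ (x + s • v - y) ≤
          Psi H₁ H₂ R t₁ t₂ (x - y) + s * (-c) := by
        refine Psi_le h.hR _ _ _ _ fun p hp => ?_
        have e3 := le_Psi h.h1 h.h2 t₁ t₂ (x - y) p hp
        have e4 := mul_le_mul_of_nonneg_left (hv p) hs.le
        rw [add_sub_right_comm, inner_add_left, real_inner_smul_left]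
        linarith
      simp only [Prod.smul_mk, Prod.mk_add_mk, smul_eq_mul, mul_one, mul_zero, add_zero]
      linarith)
    rw [hDe, real_inner_comm] at this
    simp at hc
    linarith
  have k2 : D (0, 1, 0) ≤ -H₂ q := by
    obtain ⟨v, c, hv, hc⟩ := sandwich h.v2 h.h2 (convex_singleton q) (Set.singleton_nonempty q)
      0 (-H₂ q) (by simp)
    have hc := hc q rfl
    have := dir_le hD (0, 1, v) (-c) (by
      intro s hs _
      have e1 := h.GG_le t₁ (t₂ + s) (x + s • v) y
      have e2 : Psi H₁ H₂ R t₁ (t₂ + s) (x + s • v - y) ≤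
          Psi H₁ H₂ R t₁ t₂ (x - y) + s * (-c) := by
        refine Psi_le h.hR _ _ _ _ fun p hp => ?_
        have e3 := le_Psi h.h1 h.h2 t₁ t₂ (x - y) p hp
        have e4 := mul_le_mul_of_nonneg_left (hv p) hs.le
        rw [add_sub_right_comm, inner_add_left, real_inner_smul_left]
        linarith
      simp only [Prod.smul_mk, Prod.mk_add_mk, smul_eq_mul, mul_one, mul_zero, add_zero]
      linarith)
    rw [hDe, real_inner_comm] at this
    simp at hc
    linarith
  have k3 := dir_le hD (-t₁, -t₂, -(x - y)) (-Psi H₁ H₂ R t₁ t₂ (x - y)) (by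
    intro s hs hs1
    have e1 := h.GG_le (t₁ + s * -t₁) (t₂ + s * -t₂) (x + s • -(x - y)) y
    have e2 : Psi H₁ H₂ R (t₁ + s * -t₁) (t₂ + s * -t₂) (x + s • -(x - y) - y) ≤
        (1 - s) * Psi H₁ H₂ R t₁ t₂ (x - y) := by
      refine Psi_le h.hR _ _ _ _ fun p hp => ?_
      have e3 := mul_le_mul_of_nonneg_left (le_Psi h.h1 h.h2 t₁ t₂ (x - y) p hp)
        (sub_nonneg.2 hs1)
      have e4 : x + s • -(x - y) - y = (1 - s) • (x - y) := by module
      rw [e4, real_inner_smul_left]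
      linarith
    simp only [Prod.smul_mk, Prod.mk_add_mk, smul_eq_mul]
    linarith)
  rw [hDe, inner_neg_right, real_inner_comm] at k3
  have k4 := le_Psi h.h1 h.h2 t₁ t₂ (x - y) q hqR
  have m1 := mul_le_mul_of_nonneg_left k1 ht1.le
  have m2 := mul_le_mul_of_nonneg_left k2 ht2.le
  constructor
  · have : t₁ * (D (1, 0, 0) + H₁ q) = 0 := le_antisymm (by linarith) (by linarith)
    exact (mul_eq_zero.1 this).resolve_left ht1.ne'
  · have : t₂ * (D (0, 1, 0) + H₂ q) = 0 := le_antisymm (by linarith) (by linarith)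
    exact (mul_eq_zero.1 this).resolve_left ht2.ne'

end

end LaxHJ

open LaxHJ

/-- The multi-time Lax formula `w` is Lipschitz on `[0,∞)² × ℝ^d`, differentiable at
Lebesgue-a.e. point of `(0,∞)² × ℝ^d`, solves both multi-time Hamilton–Jacobi equations
at a.e. point of `(0,∞)² × ℝ^d`, and satisfies `w(0,0,·) = g`. -/
theorem lax_solves_multitime_HJ_ae (d : ℕ) (H₁ H₂ g : EuclideanSpace ℝ (Fin d) → ℝ)
    (hH₁ : ConvexOn ℝ Set.univ H₁) (hH₂ : ConvexOn ℝ Set.univ H₂)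
    (hH₁coer : Coercive H₁) (hH₂coer : Coercive H₂)
    (K : NNReal) (hg : LipschitzWith K g) :
    (∃ L : NNReal,
      LipschitzOnWith L (fun p : ℝ × ℝ × EuclideanSpace ℝ (Fin d) => lax H₁ H₂ g p.1 p.2.1 p.2.2)
        {p : ℝ × ℝ × EuclideanSpace ℝ (Fin d) | 0 ≤ p.1 ∧ 0 ≤ p.2.1}) ∧
    (∀ x : EuclideanSpace ℝ (Fin d), lax H₁ H₂ g 0 0 x = g x) ∧
    (∀ᵐ p : ℝ × ℝ × EuclideanSpace ℝ (Fin d) ∂volume, 0 < p.1 → 0 < p.2.1 →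
      DifferentiableAt ℝ
        (fun q : ℝ × ℝ × EuclideanSpace ℝ (Fin d) => lax H₁ H₂ g q.1 q.2.1 q.2.2) p ∧
      deriv (fun s => lax H₁ H₂ g s p.2.1 p.2.2) p.1
          + H₁ (gradient (fun x' => lax H₁ H₂ g p.1 p.2.1 x') p.2.2) = 0 ∧
      deriv (fun s => lax H₁ H₂ g p.1 s p.2.2) p.2.1
          + H₂ (gradient (fun x' => lax H₁ H₂ g p.1 p.2.1 x') p.2.2) = 0) := by
  classical
  have c1 := cont_of_convex hH₁
  have c2 := cont_of_convex hH₂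
  have hcomp := isCompact_closedBall (0 : EuclideanSpace ℝ (Fin d)) ((K : ℝ) + 1)
  obtain ⟨C1, hC1⟩ := hcomp.exists_bound_of_continuousOn c1.continuousOn
  obtain ⟨C2, hC2⟩ := hcomp.exists_bound_of_continuousOn c2.continuousOn
  have h : Hyp H₁ H₂ g ((K : ℝ) + 1) (max C1 C2) K :=
    { h1 := c1, h2 := c2, v1 := hH₁, v2 := hH₂, c1 := hH₁coer, c2 := hH₂coer
      hR := by positivity
      hC1 := fun p hp => (hC1 p (by simpa using hp)).trans (le_max_left _ _)
      hC2 := fun p hp => (hC2 p (by simpa using hp)).trans (le_max_right _ _)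
      hRK := rfl
      hg := fun x y => by
        have := hg.le_add_mul x y
        rwa [dist_eq_norm] at this }
  set R : ℝ := (K : ℝ) + 1 with hR
  set C := max C1 C2
  have hC0 : 0 ≤ C := h.C_nonneg
  have hlip : LipschitzWith (R + 2 * C).toNNReal
      (fun q : ℝ × ℝ × EuclideanSpace ℝ (Fin d) => GG H₁ H₂ g R q.1 q.2.1 q.2.2) := by
    apply LipschitzWith.of_le_add_mul
    rintro ⟨s₁, s₂, x'⟩ ⟨t₁, t₂, x⟩
    have hR0 := h.hR
    rw [Real.coe_toNNReal _ (by positivity)]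
    have e := h.GG_lip t₁ t₂ s₁ s₂ x x'
    have d1 : |s₁ - t₁| ≤ dist (s₁, s₂, x') (t₁, t₂, x) := by
      rw [← Real.dist_eq, Prod.dist_eq]; exact le_max_left _ _
    have d2 : |s₂ - t₂| ≤ dist (s₁, s₂, x') (t₁, t₂, x) := by
      rw [← Real.dist_eq, Prod.dist_eq, Prod.dist_eq]
      exact (le_max_left _ _).trans (le_max_right _ _)
    have d3 : ‖x' - x‖ ≤ dist (s₁, s₂, x') (t₁, t₂, x) := by
      rw [← dist_eq_norm, Prod.dist_eq, Prod.dist_eq]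
      exact (le_max_right _ _).trans (le_max_right _ _)
    have m1 := mul_le_mul_of_nonneg_left d1 hC0
    have m2 := mul_le_mul_of_nonneg_left d2 hC0
    have m3 := mul_le_mul_of_nonneg_left d3 hR0
    simp only
    linarith
  refine ⟨⟨(R + 2 * C).toNNReal, ?_⟩, fun x => by simp [lax], ?_⟩
  · intro p hp q hq
    simp only
    rw [h.lax_eq K.2 hp.1 hp.2, h.lax_eq K.2 hq.1 hq.2]
    exact hlip p q
  · have i1 : (volume : Measure (ℝ × EuclideanSpace ℝ (Fin d))).IsAddHaarMeasure :=
      inferInstanceAs ((volume : Measure ℝ).prod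
        (volume : Measure (EuclideanSpace ℝ (Fin d)))).IsAddHaarMeasure
    have i2 : (volume : Measure (ℝ × ℝ × EuclideanSpace ℝ (Fin d))).IsAddHaarMeasure :=
      inferInstanceAs ((volume : Measure ℝ).prod
        (volume : Measure (ℝ × EuclideanSpace ℝ (Fin d)))).IsAddHaarMeasure
    filter_upwards [hlip.ae_differentiableAt] with p hp hp1 hp2
    have hev : (fun q : ℝ × ℝ × EuclideanSpace ℝ (Fin d) => lax H₁ H₂ g q.1 q.2.1 q.2.2) =ᶠ[𝓝 p]
        (fun q : ℝ × ℝ × EuclideanSpace ℝ (Fin d) => GG H₁ H₂ g R q.1 q.2.1 q.2.2) := by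
      have o1 : ∀ᶠ q : ℝ × ℝ × EuclideanSpace ℝ (Fin d) in 𝓝 p, 0 < q.1 :=
        continuousAt_fst.eventually (lt_mem_nhds hp1)
      have o2 : ∀ᶠ q : ℝ × ℝ × EuclideanSpace ℝ (Fin d) in 𝓝 p, 0 < q.2.1 :=
        (continuousAt_fst.comp continuousAt_snd).eventually (lt_mem_nhds hp2)
      filter_upwards [o1, o2] with q h1 h2
      exact h.lax_eq K.2 h1.le h2.le _
    have hD := hp.hasFDerivAt
    have hL := hD.congr_of_eventuallyEq hev
    obtain ⟨t₁, t₂, x⟩ := p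
    set D := fderiv ℝ (fun q : ℝ × ℝ × EuclideanSpace ℝ (Fin d) => GG H₁ H₂ g R q.1 q.2.1 q.2.2)
      (t₁, t₂, x)
    have l1 : HasDerivAt (fun s : ℝ => lax H₁ H₂ g s t₂ x) (D (1, 0, 0)) t₁ :=
      hL.comp_hasDerivAt t₁ (f := fun s : ℝ => (s, t₂, x))
        ((hasDerivAt_id t₁).prodMk (hasDerivAt_const t₁ (t₂, x)))
    have l2 : HasDerivAt (fun s : ℝ => lax H₁ H₂ g t₁ s x) (D (0, 1, 0)) t₂ :=
      hL.comp_hasDerivAt t₂ (f := fun s : ℝ => (t₁, s, x))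
        ((hasDerivAt_const t₂ t₁).prodMk ((hasDerivAt_id t₂).prodMk (hasDerivAt_const t₂ x)))
    have l3 : HasFDerivAt (fun x' => lax H₁ H₂ g t₁ t₂ x')
        (D.comp ((0 : EuclideanSpace ℝ (Fin d) →L[ℝ] ℝ).prod
          ((0 : EuclideanSpace ℝ (Fin d) →L[ℝ] ℝ).prod (ContinuousLinearMap.id ℝ _)))) x :=
      hL.comp x (f := fun x' => (t₁, t₂, x'))
        ((hasFDerivAt_const t₁ x).prodMk ((hasFDerivAt_const t₂ x).prodMk (hasFDerivAt_id x)))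
    have hq : ∀ v, D (0, 0, v) = ⟪gradient (fun x' => lax H₁ H₂ g t₁ t₂ x') x, v⟫ := by
      intro v
      rw [gradient, InnerProductSpace.toDual_symm_apply, l3.fderiv]
      simp
    have key := h.pde hg.continuous hp1 hp2 x hD _ hq
    refine ⟨hL.differentiableAt, ?_, ?_⟩
    · rw [l1.deriv]; exact key.1
    · rw [l2.deriv]; exact key.2
end

section
/- The function w given by the multi-time Lax formula (extended by w(0,0,·) = g) is a viscosity solution of the multi-time Hamilton–Jacobi system ∂_{t₁} w + H₁(Dw) = 0, ∂_{t₂} w + H₂(Dw) = 0 on (0,∞)² × ℝ^d with initial datum g, i.e. it is both a viscosity subsolution and a viscosity supersolution. -/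
open Filter Topology
open scoped RealInnerProductSpace

/-- The open region `(0,∞)² × ℝ^d`. -/
def posTimes (d : ℕ) : Set (ℝ × ℝ × EuclideanSpace ℝ (Fin d)) :=
  {p | 0 < p.1 ∧ 0 < p.2.1}

/-- `W` is a viscosity subsolution of the multi-time Hamilton–Jacobi system
`∂_{t₁} w + H₁(Dw) = 0`, `∂_{t₂} w + H₂(Dw) = 0` on `(0,∞)² × ℝ^d`, with initial datum
`g`: it is continuous, `W(0,0,·) = g`, and at every interior local maximum point of
`W - φ` relative to `(0,∞)² × ℝ^d` with `φ` of class `C¹` there, both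
`∂_{t₁}φ + H₁(Dφ) ≤ 0` and `∂_{t₂}φ + H₂(Dφ) ≤ 0`. -/
def IsViscositySubsolution {d : ℕ} (H₁ H₂ g : EuclideanSpace ℝ (Fin d) → ℝ)
    (W : ℝ × ℝ × EuclideanSpace ℝ (Fin d) → ℝ) : Prop :=
  ContinuousOn W (posTimes d) ∧ (∀ x, W (0, 0, x) = g x) ∧
  ∀ φ : ℝ × ℝ × EuclideanSpace ℝ (Fin d) → ℝ, ContDiffOn ℝ 1 φ (posTimes d) →
    ∀ (τ₁ τ₂ : ℝ) (ξ : EuclideanSpace ℝ (Fin d)), 0 < τ₁ → 0 < τ₂ →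
      IsLocalMaxOn (fun p => W p - φ p) (posTimes d) (τ₁, τ₂, ξ) →
      deriv (fun s => φ (s, τ₂, ξ)) τ₁ + H₁ (gradient (fun x' => φ (τ₁, τ₂, x')) ξ) ≤ 0 ∧
      deriv (fun s => φ (τ₁, s, ξ)) τ₂ + H₂ (gradient (fun x' => φ (τ₁, τ₂, x')) ξ) ≤ 0

/-- `W` is a viscosity supersolution of the multi-time Hamilton–Jacobi system: at every
interior local minimum point of `W - φ` the reverse inequalities `≥ 0` hold. -/
def IsViscositySupersolution {d : ℕ} (H₁ H₂ g : EuclideanSpace ℝ (Fin d) → ℝ)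
    (W : ℝ × ℝ × EuclideanSpace ℝ (Fin d) → ℝ) : Prop :=
  ContinuousOn W (posTimes d) ∧ (∀ x, W (0, 0, x) = g x) ∧
  ∀ φ : ℝ × ℝ × EuclideanSpace ℝ (Fin d) → ℝ, ContDiffOn ℝ 1 φ (posTimes d) →
    ∀ (τ₁ τ₂ : ℝ) (ξ : EuclideanSpace ℝ (Fin d)), 0 < τ₁ → 0 < τ₂ →
      IsLocalMinOn (fun p => W p - φ p) (posTimes d) (τ₁, τ₂, ξ) →
      0 ≤ deriv (fun s => φ (s, τ₂, ξ)) τ₁ + H₁ (gradient (fun x' => φ (τ₁, τ₂, x')) ξ) ∧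
      0 ≤ deriv (fun s => φ (τ₁, s, ξ)) τ₂ + H₂ (gradient (fun x' => φ (τ₁, τ₂, x')) ξ)


section aux
variable {d : ℕ}

lemma aux_cont {H : EuclideanSpace ℝ (Fin d) → ℝ} (hH : ConvexOn ℝ Set.univ H) : Continuous H :=
  continuousOn_univ.1 (hH.continuousOn isOpen_univ)

lemma aux_upper {H : EuclideanSpace ℝ (Fin d) → ℝ} (hc : Continuous H) (R : ℝ) :
    ∃ M, 0 ≤ M ∧ ∀ y, ‖y‖ ≤ R → |H y| ≤ M := by
  obtain ⟨M, hM⟩ := (isCompact_closedBall (0 : EuclideanSpace ℝ (Fin d)) R).exists_bound_of_continuousOn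
    hc.continuousOn
  refine ⟨max M 0, le_max_right _ _, fun y hy => ?_⟩
  exact (hM y (by simpa using hy)).trans (le_max_left _ _)

lemma aux_lower {H : EuclideanSpace ℝ (Fin d) → ℝ} (hc : Continuous H) (hco : Coercive H) (N : ℝ) :
    ∃ C, 0 ≤ C ∧ ∀ y, N * ‖y‖ - C ≤ H y := by
  have h1 := hco.eventually_ge_atTop N
  rw [eventually_comap] at h1
  obtain ⟨R, hR⟩ := eventually_atTop.1 h1
  obtain ⟨M, hM0, hM⟩ := aux_upper hc (max R 1)
  refine ⟨M + |N| * max R 1, by positivity, fun y => ?_⟩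
  by_cases hy : ‖y‖ ≤ max R 1
  · have h2 := (abs_le.1 (hM y hy)).1
    have h3 : N * ‖y‖ ≤ |N| * max R 1 :=
      mul_le_mul (le_abs_self N) hy (norm_nonneg _) (abs_nonneg _)
    linarith
  · push Not at hy
    have h2 := hR ‖y‖ ((le_max_left _ _).trans hy.le) y rfl
    have h4 : 0 < ‖y‖ := lt_of_lt_of_le one_pos ((le_max_right _ _).trans hy.le)
    rw [le_div_iff₀ h4] at h2
    have : 0 ≤ |N| * max R 1 := by positivity
    linarith

lemma aux_subgrad {H : EuclideanSpace ℝ (Fin d) → ℝ} (hH : ConvexOn ℝ Set.univ H)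
    (p : EuclideanSpace ℝ (Fin d)) {a : ℝ} (ha : a < H p) :
    ∃ q : EuclideanSpace ℝ (Fin d), ∀ y, ⟪q, y⟫ - H y ≤ ⟪q, p⟫ - a := by
  obtain ⟨l, c, h1, h2⟩ := hH.exists_affine_le_of_lt (𝕜 := ℝ) (Set.mem_univ p) ha isClosed_univ
    ((aux_cont hH).lowerSemicontinuous.lowerSemicontinuousOn _)
  refine ⟨(InnerProductSpace.toDual ℝ _).symm l, fun y => ?_⟩
  have h3 := h1 ⟨y, Set.mem_univ y⟩
  simp at h3 h2
  simp only [InnerProductSpace.toDual_symm_apply]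
  linarith

lemma aux_bdd {H₁ H₂ : EuclideanSpace ℝ (Fin d) → ℝ} (hc1 : Continuous H₁) (hc2 : Continuous H₂)
    (h1 : Coercive H₁) (h2 : Coercive H₂) {t₁ t₂ : ℝ} (ht1 : 0 < t₁) (ht2 : 0 < t₂)
    (z : EuclideanSpace ℝ (Fin d)) :
    BddAbove (Set.range fun y => ⟪z, y⟫ - (t₁ * H₁ y + t₂ * H₂ y)) := by
  obtain ⟨C, -, hC⟩ := aux_lower hc1 h1 (‖z‖ / t₁)
  obtain ⟨C', -, hC'⟩ := aux_lower hc2 h2 0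
  refine ⟨t₁ * C + t₂ * C', ?_⟩
  rintro _ ⟨y, rfl⟩
  have h3 := real_inner_le_norm z y
  have h4 := mul_le_mul_of_nonneg_left (hC y) ht1.le
  have h5 := mul_le_mul_of_nonneg_left (hC' y) ht2.le
  have h6 : t₁ * (‖z‖ / t₁ * ‖y‖ - C) = ‖z‖ * ‖y‖ - t₁ * C := by field_simp
  simp only
  linarith

lemma aux_le_conj {H₁ H₂ : EuclideanSpace ℝ (Fin d) → ℝ} (hc1 : Continuous H₁) (hc2 : Continuous H₂)
    (h1 : Coercive H₁) (h2 : Coercive H₂) {t₁ t₂ : ℝ} (ht1 : 0 < t₁) (ht2 : 0 < t₂)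
    (z y : EuclideanSpace ℝ (Fin d)) :
    ⟪z, y⟫ - (t₁ * H₁ y + t₂ * H₂ y) ≤ legendreConj (fun ξ => t₁ * H₁ ξ + t₂ * H₂ ξ) z :=
  le_ciSup (aux_bdd hc1 hc2 h1 h2 ht1 ht2 z) y

/-- uniform linear lower bound -/
lemma aux_conj_lower {H₁ H₂ : EuclideanSpace ℝ (Fin d) → ℝ} (hc1 : Continuous H₁)
    (hc2 : Continuous H₂) (h1 : Coercive H₁) (h2 : Coercive H₂) {R : ℝ} (hR : 0 ≤ R) :
    ∃ M, 0 ≤ M ∧ ∀ t₁ t₂ : ℝ, 0 < t₁ → 0 < t₂ → ∀ z : EuclideanSpace ℝ (Fin d),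
      R * ‖z‖ - (t₁ + t₂) * M ≤ legendreConj (fun ξ => t₁ * H₁ ξ + t₂ * H₂ ξ) z := by
  obtain ⟨M₁, hM₁0, hM₁⟩ := aux_upper hc1 R
  obtain ⟨M₂, hM₂0, hM₂⟩ := aux_upper hc2 R
  refine ⟨max M₁ M₂, le_max_of_le_left hM₁0, fun t₁ t₂ ht1 ht2 z => ?_⟩
  have hn : ‖(R / ‖z‖) • z‖ ≤ R := by
    rw [norm_smul, norm_div, norm_norm, Real.norm_of_nonneg hR]
    by_cases hz : ‖z‖ = 0
    · simp [hz, hR]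
    · rw [div_mul_cancel₀ _ hz]
  have hi : ⟪z, (R / ‖z‖) • z⟫ = R * ‖z‖ := by
    rw [real_inner_smul_right, real_inner_self_eq_norm_sq]
    by_cases hz : ‖z‖ = 0
    · simp [hz]
    · field_simp
  have h3 := aux_le_conj hc1 hc2 h1 h2 ht1 ht2 z ((R / ‖z‖) • z)
  rw [hi] at h3
  have h4 := mul_le_mul_of_nonneg_left
    (((le_abs_self _).trans (hM₁ _ hn)).trans (le_max_left M₁ M₂)) ht1.le
  have h5 := mul_le_mul_of_nonneg_left
    (((le_abs_self _).trans (hM₂ _ hn)).trans (le_max_right M₁ M₂)) ht2.le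
  linarith

lemma aux_g {g : EuclideanSpace ℝ (Fin d) → ℝ} {K : NNReal} (hg : LipschitzWith K g)
    (x y : EuclideanSpace ℝ (Fin d)) : g x ≤ g y + K * ‖x - y‖ := by
  have := hg.dist_le_mul x y
  rw [Real.dist_eq, dist_eq_norm] at this
  linarith [le_abs_self (g x - g y)]

lemma aux_lax_eq {H₁ H₂ g : EuclideanSpace ℝ (Fin d) → ℝ} {t₁ t₂ : ℝ} (ht1 : 0 < t₁)
    (x : EuclideanSpace ℝ (Fin d)) : lax H₁ H₂ g t₁ t₂ x =
      ⨅ y, (legendreConj (fun ξ => t₁ * H₁ ξ + t₂ * H₂ ξ) (x - y) + g y) := by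
  simp [lax, ht1.ne']

lemma aux_lax_le {H₁ H₂ g : EuclideanSpace ℝ (Fin d) → ℝ} (hc1 : Continuous H₁)
    (hc2 : Continuous H₂) (h1 : Coercive H₁) (h2 : Coercive H₂) {K : NNReal}
    (hg : LipschitzWith K g) {t₁ t₂ : ℝ} (ht1 : 0 < t₁) (ht2 : 0 < t₂)
    (x y : EuclideanSpace ℝ (Fin d)) : lax H₁ H₂ g t₁ t₂ x ≤
      legendreConj (fun ξ => t₁ * H₁ ξ + t₂ * H₂ ξ) (x - y) + g y := by
  rw [aux_lax_eq ht1]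
  refine ciInf_le ?_ y
  obtain ⟨M, -, hM⟩ := aux_conj_lower hc1 hc2 h1 h2 K.2
  refine ⟨g x - (t₁ + t₂) * M, ?_⟩
  rintro _ ⟨y, rfl⟩
  have h3 := hM t₁ t₂ ht1 ht2 (x - y)
  have h4 := aux_g hg x y
  simp only [NNReal.val_eq_coe] at h3 ⊢
  linarith

/-- semigroup inequality -/
lemma aux_step {H₁ H₂ g : EuclideanSpace ℝ (Fin d) → ℝ} (hc1 : Continuous H₁)
    (hc2 : Continuous H₂) (h1 : Coercive H₁) (h2 : Coercive H₂) {K : NNReal}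
    (hg : LipschitzWith K g) {t₁ t₂ k₁ k₂ c : ℝ} (ht1 : 0 < t₁) (ht2 : 0 < t₂)
    (hk1 : 0 ≤ k₁) (hk2 : 0 ≤ k₂) (x q : EuclideanSpace ℝ (Fin d))
    (hq : ∀ y, ⟪q, y⟫ - (k₁ * H₁ y + k₂ * H₂ y) ≤ c) :
    lax H₁ H₂ g (t₁ + k₁) (t₂ + k₂) (x + q) ≤ lax H₁ H₂ g t₁ t₂ x + c := by
  rw [← sub_le_iff_le_add, aux_lax_eq ht1 x]
  refine le_ciInf fun y => ?_
  rw [sub_le_iff_le_add]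
  refine (aux_lax_le hc1 hc2 h1 h2 hg (by linarith) (by linarith) _ y).trans ?_
  have : legendreConj (fun ξ => (t₁ + k₁) * H₁ ξ + (t₂ + k₂) * H₂ ξ) (x + q - y) ≤
      legendreConj (fun ξ => t₁ * H₁ ξ + t₂ * H₂ ξ) (x - y) + c := by
    refine ciSup_le fun v => ?_
    have h3 := aux_le_conj hc1 hc2 h1 h2 ht1 ht2 (x - y) v
    have h4 := hq v
    have h5 : ⟪x + q - y, v⟫ = ⟪x - y, v⟫ + ⟪q, v⟫ := by
      rw [← inner_add_left]; congr 1; abel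
    rw [h5]; linarith
  linarith

/-- scaling inequality -/
lemma aux_scale {H₁ H₂ g : EuclideanSpace ℝ (Fin d) → ℝ} (hc1 : Continuous H₁)
    (hc2 : Continuous H₂) (h1 : Coercive H₁) (h2 : Coercive H₂) {K : NNReal}
    (hg : LipschitzWith K g) {t₁ t₂ r : ℝ} (ht1 : 0 < t₁) (ht2 : 0 < t₂)
    (hr : 0 < r) (y z : EuclideanSpace ℝ (Fin d)) :
    lax H₁ H₂ g (r * t₁) (r * t₂) (y + r • z) ≤
      r * legendreConj (fun ξ => t₁ * H₁ ξ + t₂ * H₂ ξ) z + g y := by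
  refine (aux_lax_le hc1 hc2 h1 h2 hg (by positivity) (by positivity) _ y).trans ?_
  gcongr
  rw [add_sub_cancel_left]
  refine ciSup_le fun v => ?_
  have h3 := mul_le_mul_of_nonneg_left (aux_le_conj hc1 hc2 h1 h2 ht1 ht2 z v) hr.le
  rw [real_inner_smul_left]
  linarith

/-- attained infimum -/
lemma aux_attain {H₁ H₂ g : EuclideanSpace ℝ (Fin d) → ℝ} (hc1 : Continuous H₁)
    (hc2 : Continuous H₂) (h1 : Coercive H₁) (h2 : Coercive H₂) {K : NNReal}
    (hg : LipschitzWith K g) {t₁ t₂ : ℝ} (ht1 : 0 < t₁) (ht2 : 0 < t₂)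
    (x : EuclideanSpace ℝ (Fin d)) :
    ∃ y, legendreConj (fun ξ => t₁ * H₁ ξ + t₂ * H₂ ξ) (x - y) + g y ≤ lax H₁ H₂ g t₁ t₂ x := by
  have hconv : ConvexOn ℝ Set.univ (legendreConj (fun ξ => t₁ * H₁ ξ + t₂ * H₂ ξ)) := by
    refine ⟨convex_univ, fun u _ v _ a b ha hb hab => ?_⟩
    refine ciSup_le fun w => ?_
    have h3 := mul_le_mul_of_nonneg_left (aux_le_conj hc1 hc2 h1 h2 ht1 ht2 u w) ha
    have h4 := mul_le_mul_of_nonneg_left (aux_le_conj hc1 hc2 h1 h2 ht1 ht2 v w) hb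
    rw [inner_add_left, real_inner_smul_left, real_inner_smul_left, smul_eq_mul, smul_eq_mul]
    have h5 : t₁ * H₁ w + t₂ * H₂ w = a * (t₁ * H₁ w + t₂ * H₂ w) + b * (t₁ * H₁ w + t₂ * H₂ w) := by
      rw [← add_mul, hab, one_mul]
    linarith
  have hcont := aux_cont hconv
  obtain ⟨M, -, hM⟩ := aux_conj_lower hc1 hc2 h1 h2 (R := K + 1) (by positivity)
  have hlim : Tendsto (fun y => legendreConj (fun ξ => t₁ * H₁ ξ + t₂ * H₂ ξ) (x - y) + g y)
      (cocompact _) atTop := by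
    have h6 : Tendsto (fun y : EuclideanSpace ℝ (Fin d) => ‖y‖ + (g x - ‖x‖ - (t₁ + t₂) * M))
        (cocompact _) atTop :=
      tendsto_atTop_add_const_right _ _ tendsto_norm_cocompact_atTop
    refine tendsto_atTop_mono (fun y => ?_) h6
    have h3 := hM t₁ t₂ ht1 ht2 (x - y)
    have h4 := aux_g hg x y
    have h5 : ‖y‖ ≤ ‖x‖ + ‖x - y‖ := by
      have := norm_sub_le x (x - y)
      simpa using this
    linarith
  obtain ⟨y, hy⟩ := Continuous.exists_forall_le
    ((hcont.comp (continuous_const.sub continuous_id)).add hg.continuous) hlim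
  refine ⟨y, ?_⟩
  rw [aux_lax_eq ht1]
  exact le_ciInf hy

/-- Lipschitz in space -/
lemma aux_lipx {H₁ H₂ g : EuclideanSpace ℝ (Fin d) → ℝ} (hc1 : Continuous H₁)
    (hc2 : Continuous H₂) (h1 : Coercive H₁) (h2 : Coercive H₂) {K : NNReal}
    (hg : LipschitzWith K g) {t₁ t₂ : ℝ} (ht1 : 0 < t₁) (ht2 : 0 < t₂)
    (x x' : EuclideanSpace ℝ (Fin d)) :
    lax H₁ H₂ g t₁ t₂ x ≤ lax H₁ H₂ g t₁ t₂ x' + K * ‖x - x'‖ := by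
  obtain ⟨y, hy⟩ := aux_attain hc1 hc2 h1 h2 hg ht1 ht2 x'
  have h3 := aux_lax_le hc1 hc2 h1 h2 hg ht1 ht2 x (y + (x - x'))
  have h4 := aux_g hg (y + (x - x')) y
  rw [show x - (y + (x - x')) = x' - y by abel] at h3
  rw [show y + (x - x') - y = x - x' by abel] at h4
  linarith

lemma aux_time {H₁ H₂ g : EuclideanSpace ℝ (Fin d) → ℝ} (hc1 : Continuous H₁)
    (hc2 : Continuous H₂) (h1 : Coercive H₁) (h2 : Coercive H₂) {K : NNReal}
    (hg : LipschitzWith K g) : ∃ M, 0 ≤ M ∧ ∀ t₁ t₂ s₁ s₂ r : ℝ, 0 < t₁ → 0 < t₂ → 0 < r → r ≤ 1 →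
      r * t₁ ≤ s₁ → r * t₂ ≤ s₂ → ∀ x : EuclideanSpace ℝ (Fin d),
    lax H₁ H₂ g s₁ s₂ x ≤ lax H₁ H₂ g t₁ t₂ x +
      M * ((1 - r) * (t₁ + t₂) + (s₁ - r * t₁) + (s₂ - r * t₂)) := by
  obtain ⟨M, hM0, hM⟩ := aux_conj_lower hc1 hc2 h1 h2 K.2
  obtain ⟨C₁, hC₁0, hC₁⟩ := aux_lower hc1 h1 0
  obtain ⟨C₂, hC₂0, hC₂⟩ := aux_lower hc2 h2 0
  refine ⟨M + C₁ + C₂, by positivity, ?_⟩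
  intro t₁ t₂ s₁ s₂ r ht1 ht2 hr hr1 hs1 hs2 x
  obtain ⟨y, hy⟩ := aux_attain hc1 hc2 h1 h2 hg ht1 ht2 x
  have a1 := aux_scale hc1 hc2 h1 h2 hg ht1 ht2 hr (y + (1 - r) • (x - y)) (x - y)
  have e1 : y + (1 - r) • (x - y) + r • (x - y) = x := by module
  rw [e1] at a1
  have a2 := aux_g hg (y + (1 - r) • (x - y)) y
  rw [add_sub_cancel_left, norm_smul, Real.norm_of_nonneg (by linarith)] at a2
  have a3 := hM t₁ t₂ ht1 ht2 (x - y)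
  simp only [NNReal.val_eq_coe] at a3
  have a4 := mul_le_mul_of_nonneg_left a3 (show 0 ≤ 1 - r by linarith)
  have a5 := aux_step hc1 hc2 h1 h2 hg (mul_pos hr ht1) (mul_pos hr ht2)
    (sub_nonneg.2 hs1) (sub_nonneg.2 hs2) x 0
    (c := (s₁ - r * t₁) * C₁ + (s₂ - r * t₂) * C₂) (by
      intro v
      have b1 := mul_le_mul_of_nonneg_left (hC₁ v) (sub_nonneg.2 hs1)
      have b2 := mul_le_mul_of_nonneg_left (hC₂ v) (sub_nonneg.2 hs2)
      rw [inner_zero_left]; linarith)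
  rw [add_zero, add_sub_cancel, add_sub_cancel] at a5
  have p1 : 0 ≤ (1 - r) * (t₁ + t₂) := mul_nonneg (by linarith) (by linarith)
  have p2 := sub_nonneg.2 hs1
  have p3 := sub_nonneg.2 hs2
  have n1 := mul_nonneg p1 (add_nonneg hC₁0 hC₂0)
  have n2 := mul_nonneg p2 (add_nonneg hM0 hC₂0)
  have n3 := mul_nonneg p3 (add_nonneg hM0 hC₁0)
  linarith

lemma aux_contOn {H₁ H₂ g : EuclideanSpace ℝ (Fin d) → ℝ} (hc1 : Continuous H₁)
    (hc2 : Continuous H₂) (h1 : Coercive H₁) (h2 : Coercive H₂) {K : NNReal}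
    (hg : LipschitzWith K g) : ContinuousOn
      (fun p : ℝ × ℝ × EuclideanSpace ℝ (Fin d) => lax H₁ H₂ g p.1 p.2.1 p.2.2) (posTimes d) := by
  obtain ⟨M, hM0, hM⟩ := aux_time hc1 hc2 h1 h2 hg
  rintro ⟨t₁, t₂, x⟩ ⟨ht1, ht2⟩
  simp only at ht1 ht2
  let r : ℝ × ℝ × EuclideanSpace ℝ (Fin d) → ℝ := fun p => min 1 (min (p.1 / t₁) (p.2.1 / t₂))
  let r' : ℝ × ℝ × EuclideanSpace ℝ (Fin d) → ℝ := fun p => min 1 (min (t₁ / p.1) (t₂ / p.2.1))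
  let U : ℝ × ℝ × EuclideanSpace ℝ (Fin d) → ℝ := fun p => lax H₁ H₂ g t₁ t₂ x +
    M * ((1 - r p) * (t₁ + t₂) + (p.1 - r p * t₁) + (p.2.1 - r p * t₂)) + K * ‖p.2.2 - x‖
  let L : ℝ × ℝ × EuclideanSpace ℝ (Fin d) → ℝ := fun p => lax H₁ H₂ g t₁ t₂ x -
    M * ((1 - r' p) * (p.1 + p.2.1) + (t₁ - r' p * p.1) + (t₂ - r' p * p.2.1)) - K * ‖x - p.2.2‖
  have hr : ContinuousAt r (t₁, t₂, x) := by
    have : Continuous r := by fun_prop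
    exact this.continuousAt
  have hr' : ContinuousAt r' (t₁, t₂, x) := by
    have e1 : ContinuousAt (fun p : ℝ × ℝ × EuclideanSpace ℝ (Fin d) => t₁ / p.1) (t₁, t₂, x) :=
      continuousAt_const.div (by fun_prop) ht1.ne'
    have e2 : ContinuousAt (fun p : ℝ × ℝ × EuclideanSpace ℝ (Fin d) => t₂ / p.2.1) (t₁, t₂, x) :=
      continuousAt_const.div (by fun_prop) ht2.ne'
    exact continuousAt_const.min (e1.min e2)
  have hU : ContinuousAt U (t₁, t₂, x) := by fun_prop
  have hL : ContinuousAt L (t₁, t₂, x) := by fun_prop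
  have v1 : r (t₁, t₂, x) = 1 := by simp [r, ht1.ne', ht2.ne']
  have v2 : r' (t₁, t₂, x) = 1 := by simp [r', ht1.ne', ht2.ne']
  have hU0 : U (t₁, t₂, x) = lax H₁ H₂ g t₁ t₂ x := by simp [U, v1]
  have hL0 : L (t₁, t₂, x) = lax H₁ H₂ g t₁ t₂ x := by simp [L, v2]
  have hU2 := (hU.continuousWithinAt (s := posTimes d)).tendsto
  have hL2 := (hL.continuousWithinAt (s := posTimes d)).tendsto
  rw [hU0] at hU2
  rw [hL0] at hL2
  refine tendsto_of_tendsto_of_tendsto_of_le_of_le' hL2 hU2 ?_ ?_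
  · filter_upwards [self_mem_nhdsWithin] with p hp
    obtain ⟨hp1, hp2⟩ := hp
    have q1 : r' p * p.1 ≤ t₁ := by
      rw [← le_div_iff₀ hp1]; exact (min_le_right _ _).trans (min_le_left _ _)
    have q2 : r' p * p.2.1 ≤ t₂ := by
      rw [← le_div_iff₀ hp2]; exact (min_le_right _ _).trans (min_le_right _ _)
    have q3 : 0 < r' p := lt_min one_pos (lt_min (by positivity) (by positivity))
    have q4 := hM p.1 p.2.1 t₁ t₂ (r' p) hp1 hp2 q3 (min_le_left _ _) q1 q2 p.2.2
    have q5 := aux_lipx hc1 hc2 h1 h2 hg ht1 ht2 x p.2.2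
    simp only [L]
    linarith
  · filter_upwards [self_mem_nhdsWithin] with p hp
    obtain ⟨hp1, hp2⟩ := hp
    have q1 : r p * t₁ ≤ p.1 := by
      rw [← le_div_iff₀ ht1]; exact (min_le_right _ _).trans (min_le_left _ _)
    have q2 : r p * t₂ ≤ p.2.1 := by
      rw [← le_div_iff₀ ht2]; exact (min_le_right _ _).trans (min_le_right _ _)
    have q3 : 0 < r p := lt_min one_pos (lt_min (by positivity) (by positivity))
    have q4 := hM t₁ t₂ p.1 p.2.1 (r p) ht1 ht2 q3 (min_le_left _ _) q1 q2 x
    have q5 := aux_lipx hc1 hc2 h1 h2 hg hp1 hp2 p.2.2 x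
    simp only [U]
    linarith

lemma aux_dir {F : Type*} [NormedAddCommGroup F] [NormedSpace ℝ F] {φ : F → ℝ} {A : F →L[ℝ] ℝ}
    {P v : F} (hA : HasFDerivAt φ A P) {c : ℝ}
    (h : ∀ᶠ s in 𝓝[>] (0 : ℝ), φ (P + s • v) - φ P ≤ s * c) : A v ≤ c := by
  have h1 : HasDerivAt (fun s : ℝ => φ (P + s • v)) (A v) 0 := by
    have e : HasDerivAt (fun s : ℝ => P + s • v) v 0 := by
      simpa using ((hasDerivAt_id (0 : ℝ)).smul_const v).const_add P
    have hA' : HasFDerivAt φ A ((fun s : ℝ => P + s • v) 0) := by simpa using hA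
    exact hA'.comp_hasDerivAt 0 e
  have h2 := h1.tendsto_slope_zero_right
  refine le_of_tendsto h2 ?_
  filter_upwards [h, self_mem_nhdsWithin] with s hs hs0
  have hs0' : (0 : ℝ) < s := hs0
  simp only [zero_add, zero_smul, add_zero, smul_eq_mul]
  rw [inv_mul_le_iff₀ hs0']
  exact hs

lemma aux_ev {F : Type*} [NormedAddCommGroup F] [NormedSpace ℝ F] {P : F} (v : F) {p : F → Prop}
    (h : ∀ᶠ y in 𝓝 P, p y) : ∀ᶠ s in 𝓝[>] (0 : ℝ), p (P + s • v) := by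
  have : Tendsto (fun s : ℝ => P + s • v) (𝓝[>] (0 : ℝ)) (𝓝 P) := by
    have hc : Continuous (fun s : ℝ => P + s • v) := by fun_prop
    have := hc.tendsto 0
    simp only [zero_smul, add_zero] at this
    exact this.mono_left nhdsWithin_le_nhds
  exact this.eventually h

lemma aux_open : IsOpen (posTimes d) :=
  (isOpen_lt continuous_const continuous_fst).inter
    (isOpen_lt continuous_const (continuous_fst.comp continuous_snd))

lemma aux_deriv {φ : ℝ × ℝ × EuclideanSpace ℝ (Fin d) → ℝ} {t₁ t₂ : ℝ}
    {x : EuclideanSpace ℝ (Fin d)} (hφ : DifferentiableAt ℝ φ (t₁, t₂, x)) :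
    ∃ A : (ℝ × ℝ × EuclideanSpace ℝ (Fin d)) →L[ℝ] ℝ, HasFDerivAt φ A (t₁, t₂, x) ∧
      ∀ a b q, A (a, b, q) = a * deriv (fun s => φ (s, t₂, x)) t₁ +
        b * deriv (fun s => φ (t₁, s, x)) t₂ + ⟪q, gradient (fun x' => φ (t₁, t₂, x')) x⟫ := by
  refine ⟨fderiv ℝ φ (t₁, t₂, x), hφ.hasFDerivAt, fun a b q => ?_⟩
  have hA := hφ.hasFDerivAt
  set A := fderiv ℝ φ (t₁, t₂, x)
  have e1 : HasDerivAt (fun s => φ (s, t₂, x)) (A (1, 0, 0)) t₁ :=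
    hA.comp_hasDerivAt t₁ ((hasDerivAt_id t₁).prodMk (hasDerivAt_const t₁ (t₂, x)))
  have e2 : HasDerivAt (fun s => φ (t₁, s, x)) (A (0, 1, 0)) t₂ :=
    hA.comp_hasDerivAt t₂ ((hasDerivAt_const t₂ t₁).prodMk
      ((hasDerivAt_id t₂).prodMk (hasDerivAt_const t₂ x)))
  have e3 := hA.comp x ((hasFDerivAt_const t₁ x).prodMk
      ((hasFDerivAt_const t₂ x).prodMk (hasFDerivAt_id (𝕜 := ℝ) x)))
  have e4 := e3.hasGradientAt.gradient
  have e5 : gradient (fun x' => φ (t₁, t₂, x')) x = _ := e4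
  rw [e1.deriv, e2.deriv, e5, real_inner_comm, InnerProductSpace.toDual_symm_apply]
  have e6 : ((a, b, q) : ℝ × ℝ × EuclideanSpace ℝ (Fin d)) =
      a • (1, 0, 0) + b • (0, 1, 0) + (0, 0, q) := by simp
  rw [e6, map_add, map_add, map_smul, map_smul]
  simp

lemma aux_max {H₁ H₂ g : EuclideanSpace ℝ (Fin d) → ℝ} (hc1 : Continuous H₁)
    (hc2 : Continuous H₂) (h1 : Coercive H₁) (h2 : Coercive H₂) {K : NNReal}
    (hg : LipschitzWith K g) {t₁ t₂ k₁ k₂ c : ℝ} (ht1 : 0 < t₁) (ht2 : 0 < t₂)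
    (hk1 : 0 ≤ k₁) (hk2 : 0 ≤ k₂) (x q : EuclideanSpace ℝ (Fin d))
    (hq : ∀ y, ⟪q, y⟫ - (k₁ * H₁ y + k₂ * H₂ y) ≤ c)
    {φ : ℝ × ℝ × EuclideanSpace ℝ (Fin d) → ℝ}
    {A : (ℝ × ℝ × EuclideanSpace ℝ (Fin d)) →L[ℝ] ℝ} (hA : HasFDerivAt φ A (t₁, t₂, x))
    (hm : ∀ᶠ p : ℝ × ℝ × EuclideanSpace ℝ (Fin d) in 𝓝 (t₁, t₂, x),
      lax H₁ H₂ g p.1 p.2.1 p.2.2 - φ p ≤ lax H₁ H₂ g t₁ t₂ x - φ (t₁, t₂, x)) :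
    A (k₁, k₂, q) ≤ c := by
  have hP : posTimes d ∈ 𝓝 (t₁, t₂, x) := aux_open.mem_nhds ⟨ht1, ht2⟩
  have key := aux_dir (v := -((k₁, k₂, q) : ℝ × ℝ × EuclideanSpace ℝ (Fin d))) (c := c) hA.neg (by
    filter_upwards [aux_ev (-((k₁, k₂, q) : ℝ × ℝ × EuclideanSpace ℝ (Fin d))) hm,
      aux_ev (-((k₁, k₂, q) : ℝ × ℝ × EuclideanSpace ℝ (Fin d))) hP, self_mem_nhdsWithin]
      with s hs hs2 hs0
    have hs0' : (0 : ℝ) < s := hs0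
    obtain ⟨b1, b2⟩ := hs2
    set Q := (t₁, t₂, x) + s • -((k₁, k₂, q) : ℝ × ℝ × EuclideanSpace ℝ (Fin d)) with hQ
    have e1 : Q.1 + s * k₁ = t₁ := by simp [hQ]
    have e2 : Q.2.1 + s * k₂ = t₂ := by simp [hQ]
    have e3 : Q.2.2 + s • q = x := by simp [hQ]
    have st := aux_step (g := g) (c := s * c) hc1 hc2 h1 h2 hg b1 b2 (mul_nonneg hs0'.le hk1)
      (mul_nonneg hs0'.le hk2) Q.2.2 (s • q) (by
        intro y
        have := mul_le_mul_of_nonneg_left (hq y) hs0'.le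
        rw [real_inner_smul_left]; linarith)
    rw [e1, e2, e3] at st
    simp only [Pi.neg_apply]
    linarith)
  rwa [map_neg, ContinuousLinearMap.neg_apply, neg_neg] at key

lemma aux_min {H₁ H₂ g : EuclideanSpace ℝ (Fin d) → ℝ} (hc1 : Continuous H₁)
    (hc2 : Continuous H₂) (h1 : Coercive H₁) (h2 : Coercive H₂) {K : NNReal}
    (hg : LipschitzWith K g) {t₁ t₂ k₁ k₂ c : ℝ} (ht1 : 0 < t₁) (ht2 : 0 < t₂)
    (hk1 : 0 ≤ k₁) (hk2 : 0 ≤ k₂) (x q : EuclideanSpace ℝ (Fin d))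
    (hq : ∀ y, ⟪q, y⟫ - (k₁ * H₁ y + k₂ * H₂ y) ≤ c)
    {φ : ℝ × ℝ × EuclideanSpace ℝ (Fin d) → ℝ}
    {A : (ℝ × ℝ × EuclideanSpace ℝ (Fin d)) →L[ℝ] ℝ} (hA : HasFDerivAt φ A (t₁, t₂, x))
    (hm : ∀ᶠ p : ℝ × ℝ × EuclideanSpace ℝ (Fin d) in 𝓝 (t₁, t₂, x),
      lax H₁ H₂ g t₁ t₂ x - φ (t₁, t₂, x) ≤ lax H₁ H₂ g p.1 p.2.1 p.2.2 - φ p) :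
    A (k₁, k₂, q) ≤ c := by
  refine aux_dir hA ?_
  filter_upwards [aux_ev (k₁, k₂, q) hm, self_mem_nhdsWithin] with s hs hs0
  have hs0' : (0 : ℝ) < s := hs0
  have st := aux_step (g := g) (c := s * c) hc1 hc2 h1 h2 hg ht1 ht2 (mul_nonneg hs0'.le hk1)
    (mul_nonneg hs0'.le hk2) x (s • q) (by
      intro y
      have := mul_le_mul_of_nonneg_left (hq y) hs0'.le
      rw [real_inner_smul_left]; linarith)
  simp only [Prod.smul_mk, Prod.mk_add_mk, smul_eq_mul] at hs ⊢
  linarith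

/-- ray inequality at a minimum -/
lemma aux_ray {H₁ H₂ g : EuclideanSpace ℝ (Fin d) → ℝ} (hc1 : Continuous H₁)
    (hc2 : Continuous H₂) (h1 : Coercive H₁) (h2 : Coercive H₂) {K : NNReal}
    (hg : LipschitzWith K g) {t₁ t₂ : ℝ} (ht1 : 0 < t₁) (ht2 : 0 < t₂)
    (x : EuclideanSpace ℝ (Fin d))
    {φ : ℝ × ℝ × EuclideanSpace ℝ (Fin d) → ℝ}
    {A : (ℝ × ℝ × EuclideanSpace ℝ (Fin d)) →L[ℝ] ℝ} (hA : HasFDerivAt φ A (t₁, t₂, x))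
    (hm : ∀ᶠ p : ℝ × ℝ × EuclideanSpace ℝ (Fin d) in 𝓝 (t₁, t₂, x),
      lax H₁ H₂ g t₁ t₂ x - φ (t₁, t₂, x) ≤ lax H₁ H₂ g p.1 p.2.1 p.2.2 - φ p) :
    ∃ z, legendreConj (fun ξ => t₁ * H₁ ξ + t₂ * H₂ ξ) z ≤ A (t₁, t₂, z) := by
  obtain ⟨y, hy⟩ := aux_attain hc1 hc2 h1 h2 hg ht1 ht2 x
  refine ⟨x - y, ?_⟩
  have key := aux_dir (v := -((t₁, t₂, x - y) : ℝ × ℝ × EuclideanSpace ℝ (Fin d)))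
    (c := -legendreConj (fun ξ => t₁ * H₁ ξ + t₂ * H₂ ξ) (x - y)) hA (by
    have h01 : ∀ᶠ s : ℝ in 𝓝[>] (0 : ℝ), s < 1 :=
      (eventually_lt_nhds one_pos).filter_mono nhdsWithin_le_nhds
    filter_upwards [aux_ev (-((t₁, t₂, x - y) : ℝ × ℝ × EuclideanSpace ℝ (Fin d))) hm,
      h01] with s hs hs1
    have sc := aux_scale (g := g) hc1 hc2 h1 h2 hg ht1 ht2 (sub_pos.2 hs1) y (x - y)
    set Q := (t₁, t₂, x) + s • -((t₁, t₂, x - y) : ℝ × ℝ × EuclideanSpace ℝ (Fin d)) with hQ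
    have e1 : (1 - s) * t₁ = Q.1 := by simp [hQ]; ring
    have e2 : (1 - s) * t₂ = Q.2.1 := by simp [hQ]; ring
    have e3 : y + (1 - s) • (x - y) = Q.2.2 := by
      simp only [hQ, Prod.snd_add, Prod.smul_snd, Prod.snd_neg]; module
    rw [e1, e2, e3] at sc
    linarith)
  rw [map_neg] at key
  linarith

end aux

/-- The multi-time Lax formula (extended by `w(0,0,·) = g`) is a viscosity solution,
i.e. both a viscosity subsolution and a viscosity supersolution, of the multi-time
Hamilton–Jacobi system with initial datum `g`. -/
theorem lax_is_viscosity_solution (d : ℕ) (H₁ H₂ g : EuclideanSpace ℝ (Fin d) → ℝ)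
    (hH₁ : ConvexOn ℝ Set.univ H₁) (hH₂ : ConvexOn ℝ Set.univ H₂)
    (hH₁coer : Coercive H₁) (hH₂coer : Coercive H₂)
    (K : NNReal) (hg : LipschitzWith K g) :
    IsViscositySubsolution H₁ H₂ g
        (fun p : ℝ × ℝ × EuclideanSpace ℝ (Fin d) => lax H₁ H₂ g p.1 p.2.1 p.2.2) ∧
    IsViscositySupersolution H₁ H₂ g
        (fun p : ℝ × ℝ × EuclideanSpace ℝ (Fin d) => lax H₁ H₂ g p.1 p.2.1 p.2.2) := by
  have hc1 := aux_cont hH₁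
  have hc2 := aux_cont hH₂
  have hcont := aux_contOn hc1 hc2 hH₁coer hH₂coer hg
  have hinit : ∀ x, lax H₁ H₂ g 0 0 x = g x := fun x => by simp [lax]
  have core : ∀ (a b : ℝ) (p : EuclideanSpace ℝ (Fin d)),
      (∀ (k₁ k₂ c : ℝ) (q : EuclideanSpace ℝ (Fin d)), 0 ≤ k₁ → 0 ≤ k₂ →
        (∀ y, ⟪q, y⟫ - (k₁ * H₁ y + k₂ * H₂ y) ≤ c) → k₁ * a + k₂ * b + ⟪q, p⟫ ≤ c) →
      a + H₁ p ≤ 0 ∧ b + H₂ p ≤ 0 := by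
    intro a b p h
    constructor
    · have : H₁ p ≤ -a := by
        refine le_of_forall_lt_imp_le_of_dense fun r hr => ?_
        obtain ⟨q, hq⟩ := aux_subgrad hH₁ p hr
        have := h 1 0 (⟪q, p⟫ - r) q zero_le_one le_rfl (fun y => by linarith [hq y])
        linarith
      linarith
    · have : H₂ p ≤ -b := by
        refine le_of_forall_lt_imp_le_of_dense fun r hr => ?_
        obtain ⟨q, hq⟩ := aux_subgrad hH₂ p hr
        have := h 0 1 (⟪q, p⟫ - r) q le_rfl zero_le_one (fun y => by linarith [hq y])
        linarith
      linarith
  refine ⟨⟨hcont, hinit, ?_⟩, ⟨hcont, hinit, ?_⟩⟩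
  · intro φ hφ t₁ t₂ x ht1 ht2 hmax
    have hP : posTimes d ∈ 𝓝 (t₁, t₂, x) := aux_open.mem_nhds ⟨ht1, ht2⟩
    obtain ⟨A, hA, hAe⟩ := aux_deriv ((hφ.contDiffAt hP).differentiableAt (by simp))
    have hm := hmax.isLocalMax hP
    refine core _ _ _ fun k₁ k₂ c q hk1 hk2 hq => ?_
    rw [← hAe]
    exact aux_max hc1 hc2 hH₁coer hH₂coer hg ht1 ht2 hk1 hk2 x q hq hA hm
  · intro φ hφ t₁ t₂ x ht1 ht2 hmin
    have hP : posTimes d ∈ 𝓝 (t₁, t₂, x) := aux_open.mem_nhds ⟨ht1, ht2⟩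
    obtain ⟨A, hA, hAe⟩ := aux_deriv ((hφ.contDiffAt hP).differentiableAt (by simp))
    have hm := hmin.isLocalMin hP
    obtain ⟨z, hz⟩ := aux_ray hc1 hc2 hH₁coer hH₂coer hg ht1 ht2 x hA hm
    rw [hAe] at hz
    obtain ⟨c1, c2⟩ := core (deriv (fun s => φ (s, t₂, x)) t₁) (deriv (fun s => φ (t₁, s, x)) t₂)
      (gradient (fun x' => φ (t₁, t₂, x')) x) (fun k₁ k₂ c q hk1 hk2 hq => by
        rw [← hAe]
        exact aux_min hc1 hc2 hH₁coer hH₂coer hg ht1 ht2 hk1 hk2 x q hq hA hm)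
    have h3 := aux_le_conj hc1 hc2 hH₁coer hH₂coer ht1 ht2 z
      (gradient (fun x' => φ (t₁, t₂, x')) x)
    generalize deriv (fun s => φ (s, t₂, x)) t₁ = a at *
    generalize deriv (fun s => φ (t₁, s, x)) t₂ = b at *
    generalize gradient (fun x' => φ (t₁, t₂, x')) x = p at *
    have h4 := mul_nonpos_of_nonneg_of_nonpos ht1.le c1
    have h5 := mul_nonpos_of_nonneg_of_nonpos ht2.le c2
    constructor
    · refine nonneg_of_mul_nonneg_right (a := t₁) ?_ ht1
      linarith
    · refine nonneg_of_mul_nonneg_right (a := t₂) ?_ ht2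
      linarith
end
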